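/- arXiv:2009.04328 — 2 statements merged into one kernel-verified Lean document; each statement's English description precedes it below -/
import Mathlib

section
/- Let ν be a Lévy measure on ℝ and α ∈ (0,2). If ν ∈ 𝒮₂(α), i.e., 0 < liminf_{|u|→∞} |u|^{-α} ∫(1-cos(ux))ν(dx) ≤ limsup_{|u|→∞} |u|^{-α} ∫(1-cos(ux))ν(dx) < ∞, then α = inf{ r ∈ [0,2] : ∫_{|x|≤1} |x|^r ν(dx) < ∞ }. -/
open MeasureTheory Filter

/-- A Lévy measure on `ℝ`: no mass at `0` and `∫ (x² ∧ 1) ν(dx) < ∞`. -/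
def IsLevyMeasure (ν : Measure ℝ) : Prop :=
  ν {0} = 0 ∧ ∫⁻ x, ENNReal.ofReal (min (x ^ 2) 1) ∂ν < ⊤

/-- `∫ (1 - cos(ux)) ν(dx)` as an `ℝ≥0∞`-valued integral. -/
noncomputable def cosInt (ν : Measure ℝ) (u : ℝ) : ENNReal :=
  ∫⁻ x, ENNReal.ofReal (1 - Real.cos (u * x)) ∂ν

/-- The filter `|u| → ∞`. -/
def absAtTop : Filter ℝ := Filter.comap (fun u : ℝ => |u|) Filter.atTop

/-- The class `𝒮₂(α)`: `0 < liminf_{|u|→∞} |u|^{-α} ∫(1-cos(ux))ν(dx) ≤ limsup < ∞`. -/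
noncomputable def MemS2 (α : ℝ) (ν : Measure ℝ) : Prop :=
  0 < Filter.liminf (fun u : ℝ => cosInt ν u / ENNReal.ofReal (|u| ^ α)) absAtTop ∧
  Filter.limsup (fun u : ℝ => cosInt ν u / ENNReal.ofReal (|u| ^ α)) absAtTop < ⊤

/-- The class `𝒮₁(α)`: `ν = ν₁ + ν₂` with `ν₁` having a density `k(x)/|x|^{α+1}` where `k`
is bounded away from `0` and `∞` near the origin and `k(x)/|x|^α` is monotone on each
half-line, while `ν₂` satisfies `limsup_{|u|→∞} |u|^{-α} ∫(1-cos(ux))ν₂(dx) < ∞`. -/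
noncomputable def MemS1 (α : ℝ) (ν : Measure ℝ) : Prop :=
  ∃ (ν₁ ν₂ : Measure ℝ) (k : ℝ → ℝ),
    IsLevyMeasure ν₁ ∧ IsLevyMeasure ν₂ ∧ ν = ν₁ + ν₂ ∧
    ν₁ = volume.withDensity
      (fun x => if x = 0 then 0 else ENNReal.ofReal (k x / |x| ^ (α + 1))) ∧
    (∃ c C : ℝ, 0 < c ∧ ∀ᶠ x in nhdsWithin 0 {(0 : ℝ)}ᶜ, c ≤ k x ∧ k x ≤ C) ∧
    (∀ x y : ℝ, x ≤ y → y < 0 → k x / |x| ^ α ≤ k y / |y| ^ α) ∧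
    (∀ x y : ℝ, 0 < x → x ≤ y → k y / |y| ^ α ≤ k x / |x| ^ α) ∧
    (∃ C : ℝ, ∀ᶠ u in absAtTop, cosInt ν₂ u ≤ ENNReal.ofReal (C * |u| ^ α))

/-- The elementary bound `1 - cos t ≤ 2 |t| ^ r` for every exponent `r ∈ [0, 2]`. -/
lemma one_sub_cos_le_two_mul_abs_rpow {r : ℝ} (hr : r ∈ Set.Icc (0 : ℝ) 2) (t : ℝ) :
    1 - Real.cos t ≤ 2 * |t| ^ r := by
  rcases le_or_gt |t| 1 with h | h
  · have h1 : |t| ^ (2 : ℝ) ≤ |t| ^ r := by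
      rcases (abs_nonneg t).eq_or_lt with h0 | h0
      · rw [← h0, Real.zero_rpow two_ne_zero]
        positivity
      · exact Real.rpow_le_rpow_of_exponent_ge h0 h hr.2
    rw [Real.rpow_two, sq_abs] at h1
    nlinarith [Real.one_sub_sq_div_two_le_cos (x := t), sq_nonneg t]
  · have h1 : 1 ≤ |t| ^ r := Real.one_le_rpow h.le hr.1
    linarith [Real.neg_one_le_cos t]

/-- If `|x| ^ r` is `ν`-integrable near the origin, then `cosInt ν u` grows at most like `u ^ r`. -/
lemma cosInt_le_mul_rpow (ν : Measure ℝ) {r : ℝ} (hr : r ∈ Set.Icc (0 : ℝ) 2) {u : ℝ}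
    (hu : 1 ≤ u) :
    cosInt ν u ≤ 2 * (∫⁻ x in {x : ℝ | |x| ≤ 1}, ENNReal.ofReal (|x| ^ r) ∂ν +
      ∫⁻ x, ENNReal.ofReal (min (x ^ 2) 1) ∂ν) * ENNReal.ofReal (u ^ r) := by
  have hm : MeasurableSet {x : ℝ | |x| ≤ 1} := measurableSet_le (by fun_prop) (by fun_prop)
  rw [← lintegral_indicator hm, ← lintegral_add_left (by
      exact Measurable.indicator (by fun_prop) hm), ← lintegral_const_mul _ (by
      exact (Measurable.indicator (by fun_prop) hm).add (by fun_prop)),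
    ← lintegral_mul_const _ (by
      exact ((Measurable.indicator (by fun_prop) hm).add (by fun_prop)).const_mul _)]
  refine lintegral_mono fun x => ?_
  have hur : 1 ≤ u ^ r := Real.one_le_rpow hu hr.1
  rw [show (2 : ENNReal) = ENNReal.ofReal 2 by simp]
  by_cases hx : |x| ≤ 1
  · rw [Set.indicator_of_mem (show x ∈ {x : ℝ | |x| ≤ 1} from hx)]
    calc ENNReal.ofReal (1 - Real.cos (u * x))
        ≤ ENNReal.ofReal (2 * |x| ^ r * u ^ r) := by
          refine ENNReal.ofReal_le_ofReal ((one_sub_cos_le_two_mul_abs_rpow hr _).trans ?_)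
          rw [abs_mul, abs_of_nonneg (by linarith : 0 ≤ u),
            Real.mul_rpow (by linarith) (abs_nonneg x)]
          apply le_of_eq
          ring
      _ = ENNReal.ofReal 2 * ENNReal.ofReal (|x| ^ r) * ENNReal.ofReal (u ^ r) := by
          rw [ENNReal.ofReal_mul (by positivity), ENNReal.ofReal_mul (by positivity)]
      _ ≤ _ := by
          gcongr
          exact le_self_add
  · rw [Set.indicator_of_notMem (show x ∉ {x : ℝ | |x| ≤ 1} from hx), zero_add]
    have h1 : (1 : ℝ) ≤ x ^ 2 := by
      rw [← sq_abs]
      nlinarith [abs_nonneg x]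
    rw [min_eq_right h1, ENNReal.ofReal_one, mul_one, ← ENNReal.ofReal_mul (by positivity)]
    exact ENNReal.ofReal_le_ofReal (by linarith [Real.neg_one_le_cos (u * x)])

lemma IsLevyMeasure.setLIntegral_sq_lt_top {ν : Measure ℝ} (hν : IsLevyMeasure ν) :
    ∫⁻ x in {x : ℝ | |x| ≤ 1}, ENNReal.ofReal (|x| ^ (2 : ℝ)) ∂ν < ⊤ := by
  have hm : MeasurableSet {x : ℝ | |x| ≤ 1} := measurableSet_le (by fun_prop) (by fun_prop)
  refine lt_of_le_of_lt ?_ hν.2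
  refine (setLIntegral_mono (by fun_prop) fun x hx => ?_).trans (setLIntegral_le_lintegral _ _)
  rw [Real.rpow_two, sq_abs, min_eq_left]
  exact (sq_le_one_iff_abs_le_one x).2 hx

lemma IsLevyMeasure.cosInt_lt_top {ν : Measure ℝ} (hν : IsLevyMeasure ν) {u : ℝ} (hu : 1 ≤ u) :
    cosInt ν u < ⊤ :=
  (cosInt_le_mul_rpow ν ⟨zero_le_two, le_rfl⟩ hu).trans_lt <|
    ENNReal.mul_lt_top (ENNReal.mul_lt_top (by simp)
      (ENNReal.add_lt_top.2 ⟨hν.setLIntegral_sq_lt_top, hν.2⟩)) ENNReal.ofReal_lt_top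

lemma tendsto_id_atTop_absAtTop : Tendsto (fun u : ℝ => u) atTop absAtTop :=
  tendsto_comap_iff.2 tendsto_abs_atTop_atTop

/-- A positive lower bound `cosInt ν u ≳ |u| ^ α` rules out integrability of `|x| ^ r` near the
origin for `r < α`. -/
lemma le_of_liminf_pos {α r : ℝ} {ν : Measure ℝ} (hν : IsLevyMeasure ν)
    (hr : r ∈ Set.Icc (0 : ℝ) 2)
    (hlim : 0 < liminf (fun u : ℝ => cosInt ν u / ENNReal.ofReal (|u| ^ α)) absAtTop)
    (hfin : ∫⁻ x in {x : ℝ | |x| ≤ 1}, ENNReal.ofReal (|x| ^ r) ∂ν < ⊤) : α ≤ r := by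
  by_contra! hlt
  obtain ⟨c, hc0, hc⟩ := exists_between hlim
  have hev := tendsto_id_atTop_absAtTop.eventually (eventually_lt_of_lt_liminf hc)
  set D : ENNReal := 2 * (∫⁻ x in {x : ℝ | |x| ≤ 1}, ENNReal.ofReal (|x| ^ r) ∂ν +
      ∫⁻ x, ENNReal.ofReal (min (x ^ 2) 1) ∂ν) with hD
  have hDtop : D ≠ ⊤ :=
    (ENNReal.mul_lt_top (by simp) (ENNReal.add_lt_top.2 ⟨hfin, hν.2⟩)).ne
  have htend : Tendsto (fun u : ℝ => D * ENNReal.ofReal (u ^ (-(α - r)))) atTop (nhds 0) := by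
    have h1 := ENNReal.tendsto_ofReal (tendsto_rpow_neg_atTop (sub_pos.2 hlt))
    have h2 := ENNReal.Tendsto.const_mul h1 (Or.inr hDtop)
    simpa using h2
  obtain ⟨u, h1, h2, hu⟩ :=
    (hev.and ((htend.eventually (gt_mem_nhds hc0)).and (eventually_ge_atTop 1))).exists
  have hu0 : 0 < u := by linarith
  refine absurd (h1.trans_le ?_) h2.not_gt
  rw [abs_of_pos hu0]
  refine ENNReal.div_le_of_le_mul ((cosInt_le_mul_rpow ν hr hu).trans ?_)
  rw [mul_assoc D, ← ENNReal.ofReal_mul (by positivity), ← Real.rpow_add hu0,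
    show -(α - r) + α = r by ring]

/-- Dyadic domination of `|x| ^ r` on the punctured unit interval. -/
lemma ofReal_abs_rpow_le_tsum {r : ℝ} (hr : 0 ≤ r) {x : ℝ} (hx0 : x ≠ 0) (hx : |x| ≤ 1) :
    ENNReal.ofReal (|x| ^ r) ≤ ∑' k : ℕ, ENNReal.ofReal (32 * ((2 : ℝ) ^ k) ^ (-r)) *
      ENNReal.ofReal (1 - Real.cos (2 ^ k * x)) := by
  obtain ⟨k, hk1, hk2⟩ := exists_nat_pow_near_of_lt_one (abs_pos.2 hx0) hx
    (by norm_num : (0 : ℝ) < 1 / 2) (by norm_num)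
  refine le_trans ?_ (ENNReal.le_tsum k)
  rw [← ENNReal.ofReal_mul (by positivity)]
  refine ENNReal.ofReal_le_ofReal ?_
  have h2k : (0 : ℝ) < 2 ^ k := by positivity
  have hinv : ((1 : ℝ) / 2) ^ k = (2 ^ k)⁻¹ := by simp
  rw [pow_succ, hinv] at hk1
  rw [hinv] at hk2
  set y : ℝ := 2 ^ k
  have habs : |y * x| = y * |x| := by rw [abs_mul, abs_of_pos h2k]
  have hle : |y * x| ≤ 1 := by
    rw [habs]
    calc y * |x| ≤ y * y⁻¹ := by gcongr
      _ = 1 := mul_inv_cancel₀ h2k.ne'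
  have hge : 1 / 2 ≤ |y * x| := by
    rw [habs]
    calc 1 / 2 = y * (y⁻¹ * (1 / 2)) := by field_simp
      _ ≤ y * |x| := by gcongr
  have hcos : 1 / 32 ≤ 1 - Real.cos (y * x) := by
    have h1 := Real.cos_le_one_sub_mul_cos_sq (hle.trans (by linarith [Real.pi_gt_three]))
    have h2 : 2 / (4 : ℝ) ^ 2 ≤ 2 / Real.pi ^ 2 := by
      have := Real.pi_pos
      have := Real.pi_le_four
      gcongr
    have h3 : 1 / 4 ≤ (y * x) ^ 2 := by
      rw [← sq_abs]
      nlinarith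
    nlinarith
  have hpow : |x| ^ r ≤ y ^ (-r) := by
    rw [Real.rpow_neg h2k.le, ← Real.inv_rpow h2k.le]
    exact Real.rpow_le_rpow (abs_nonneg x) hk2 hr
  have : 0 < y ^ (-r) := by positivity
  nlinarith

/-- An upper bound `cosInt ν u ≲ |u| ^ α` gives integrability of `|x| ^ r` near the origin for
`r > α`. -/
lemma setLIntegral_abs_rpow_lt_top_of_limsup {α r : ℝ} {ν : Measure ℝ} (hν : IsLevyMeasure ν)
    (hr0 : 0 ≤ r) (hr : α < r)
    (hlim : limsup (fun u : ℝ => cosInt ν u / ENNReal.ofReal (|u| ^ α)) absAtTop < ⊤) :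
    ∫⁻ x in {x : ℝ | |x| ≤ 1}, ENNReal.ofReal (|x| ^ r) ∂ν < ⊤ := by
  have hm : MeasurableSet {x : ℝ | |x| ≤ 1} := measurableSet_le (by fun_prop) (by fun_prop)
  obtain ⟨C, hC, hCtop⟩ := exists_between hlim
  have hev := (tendsto_id_atTop_absAtTop.comp
    (tendsto_pow_atTop_atTop_of_one_lt (one_lt_two (α := ℝ)))).eventually
      (eventually_lt_of_limsup_lt hC)
  obtain ⟨N, hN⟩ := eventually_atTop.1 hev
  set f : ℕ → ENNReal := fun k => cosInt ν (2 ^ k) / ENNReal.ofReal (((2 : ℝ) ^ k) ^ α) with hf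
  have hpos : ∀ k : ℕ, 0 < ENNReal.ofReal (((2 : ℝ) ^ k) ^ α) := fun k =>
    ENNReal.ofReal_pos.2 (by positivity)
  have hftop : ∀ k, f k < ⊤ := fun k =>
    ENNReal.div_lt_top (hν.cosInt_lt_top (one_le_pow₀ one_le_two)).ne (hpos k).ne'
  set M : ENNReal := C + ∑ i ∈ Finset.range N, f i with hM
  have hMtop : M < ⊤ :=
    ENNReal.add_lt_top.2 ⟨hCtop, ENNReal.sum_lt_top.2 fun i _ => hftop i⟩
  have hfM : ∀ k, f k ≤ M := by
    intro k
    rcases lt_or_ge k N with hk | hk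
    · exact (Finset.single_le_sum (f := f) (fun _ _ => zero_le)
        (Finset.mem_range.2 hk)).trans le_add_self
    · have h := hN k hk
      simp only [Function.comp_apply, abs_of_pos (by positivity : (0 : ℝ) < 2 ^ k)] at h
      exact h.le.trans le_self_add
  have hcos : ∀ k : ℕ, cosInt ν (2 ^ k) ≤ M * ENNReal.ofReal (((2 : ℝ) ^ k) ^ α) := fun k =>
    (ENNReal.div_le_iff (hpos k).ne' ENNReal.ofReal_ne_top).1 (hfM k)
  have hq : (2 : ℝ) ^ (α - r) < 1 :=
    Real.rpow_lt_one_of_one_lt_of_neg one_lt_two (sub_neg.2 hr)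
  calc ∫⁻ x in {x : ℝ | |x| ≤ 1}, ENNReal.ofReal (|x| ^ r) ∂ν
      ≤ ∫⁻ x in {x : ℝ | |x| ≤ 1}, ∑' k : ℕ, ENNReal.ofReal (32 * ((2 : ℝ) ^ k) ^ (-r)) *
          ENNReal.ofReal (1 - Real.cos (2 ^ k * x)) ∂ν := by
        have hne : ∀ᵐ x ∂ν, x ≠ 0 := by
          rw [ae_iff]
          simpa using hν.1
        refine setLIntegral_mono_ae' hm ?_
        filter_upwards [hne] with x hx0 hx
        exact ofReal_abs_rpow_le_tsum hr0 hx0 hx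
    _ ≤ ∫⁻ x, ∑' k : ℕ, ENNReal.ofReal (32 * ((2 : ℝ) ^ k) ^ (-r)) *
          ENNReal.ofReal (1 - Real.cos (2 ^ k * x)) ∂ν := setLIntegral_le_lintegral _ _
    _ = ∑' k : ℕ, ENNReal.ofReal (32 * ((2 : ℝ) ^ k) ^ (-r)) * cosInt ν (2 ^ k) := by
        rw [lintegral_tsum fun k => by fun_prop]
        refine tsum_congr fun k => ?_
        rw [lintegral_const_mul _ (by fun_prop), cosInt]
    _ ≤ ∑' k : ℕ, M * ENNReal.ofReal 32 * ENNReal.ofReal ((2 : ℝ) ^ (α - r)) ^ k := by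
        refine ENNReal.tsum_le_tsum fun k => ?_
        refine (mul_le_mul_right (hcos k) _).trans_eq ?_
        have h2k : (0 : ℝ) < 2 ^ k := by positivity
        rw [← ENNReal.ofReal_pow (by positivity), mul_left_comm, mul_assoc,
          ← ENNReal.ofReal_mul (by positivity), ← ENNReal.ofReal_mul (by positivity), mul_assoc,
          ← Real.rpow_add h2k, ← Real.rpow_natCast, ← Real.rpow_natCast,
          ← Real.rpow_mul zero_le_two, ← Real.rpow_mul zero_le_two,
          show (k : ℝ) * (-r + α) = (α - r) * k by ring]
    _ < ⊤ := by
        rw [ENNReal.tsum_mul_left, ENNReal.tsum_geometric]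
        refine ENNReal.mul_lt_top (ENNReal.mul_lt_top hMtop ENNReal.ofReal_lt_top) ?_
        rw [ENNReal.inv_lt_top, tsub_pos_iff_lt]
        exact ENNReal.ofReal_lt_one.2 hq

/-- for `ν ∈ 𝒮₂(α)`, `α` equals the Blumenthal–Getoor index
`inf { r ∈ [0,2] : ∫_{|x|≤1} |x|^r ν(dx) < ∞ }`. -/
theorem stmt5 (α : ℝ) (hα : α ∈ Set.Ioo (0 : ℝ) 2) (ν : Measure ℝ) (hν : IsLevyMeasure ν)
    (hS2 : MemS2 α ν) :
    α = sInf {r : ℝ | r ∈ Set.Icc (0 : ℝ) 2 ∧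
      ∫⁻ x in {x : ℝ | |x| ≤ 1}, ENNReal.ofReal (|x| ^ r) ∂ν < ⊤} := by
  refine le_antisymm (le_csInf ⟨2, ⟨⟨zero_le_two, le_rfl⟩, hν.setLIntegral_sq_lt_top⟩⟩ ?_) ?_
  · rintro r ⟨hr, hfin⟩
    exact le_of_liminf_pos hν hr hS2.1 hfin
  · refine le_of_forall_gt_imp_ge_of_dense fun r hr => ?_
    have hlt : α < min r 2 := lt_min hr hα.2
    have hpos : 0 ≤ min r 2 := (hα.1.trans hlt).le
    refine le_trans (csInf_le ?_ ?_) (min_le_left r 2)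
    · exact ⟨0, fun s hs => hs.1.1⟩
    · exact ⟨⟨hpos, min_le_right _ _⟩,
        setLIntegral_abs_rpow_lt_top_of_limsup hν hpos hlt hS2.2⟩
end

section
/- Let X be a Lévy process with Lévy measure ν satisfying ∫_{|x|>1} e^{qx} ν(dx) < ∞ for some q ∈ (1,∞), and for η ∈ [0,1] define Φ(η)_t := e^{X_t} sup_{u∈[0,t]} e^{(η-1)X_u}. Then Φ(η) ∈ 𝒮ℳ_q: there is a constant c ≥ 0 such that 𝔼[sup_{t∈[a,T]} Φ(η)_t^q | ℱ_a] ≤ c^q Φ(η)_a^q almost surely for all a ∈ [0,T]. -/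
open MeasureTheory Filter ProbabilityTheory

/-- The Lévy–Khintchine exponent `ψ` associated with a triplet `(γ, σ, ν)`. -/
noncomputable def levyExponent (γ σ : ℝ) (ν : Measure ℝ) (u : ℝ) : ℂ :=
  -Complex.I * γ * u + σ ^ 2 * u ^ 2 / 2 -
    ∫ x, (Complex.exp (Complex.I * u * x) - 1 -
      Complex.I * u * ({y : ℝ | |y| ≤ 1}.indicator (fun y => (y : ℂ)) x)) ∂ν

/-- `X` is a Lévy process with triplet `(γ, σ, ν)` w.r.t. the filtration `ℱ` under `μ`:
adapted, starting at `0`, càdlàg, with increments independent of the past and stationary,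
whose one-dimensional distributions are given by the Lévy–Khintchine formula. -/
def IsLevyProcess {Ω : Type*} {m0 : MeasurableSpace Ω} (μ : Measure Ω)
    (ℱ : Filtration ℝ m0) (X : ℝ → Ω → ℝ) (γ σ : ℝ) (ν : Measure ℝ) : Prop :=
  Adapted ℱ X ∧
  (∀ ω, X 0 ω = 0) ∧
  (∀ ω t, ContinuousWithinAt (fun s => X s ω) (Set.Ici t) t) ∧
  (∀ s t : ℝ, 0 ≤ s → s ≤ t →
    ProbabilityTheory.Indep
      (MeasurableSpace.comap (fun ω => X t ω - X s ω) (inferInstance : MeasurableSpace ℝ))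
      (ℱ s) μ) ∧
  (∀ s t : ℝ, 0 ≤ s → s ≤ t →
    Measure.map (fun ω => X t ω - X s ω) μ = Measure.map (X (t - s)) μ) ∧
  (∀ t : ℝ, 0 ≤ t → ∀ u : ℝ,
    ∫ ω, Complex.exp (Complex.I * u * X t ω) ∂μ
      = Complex.exp (-(t : ℂ) * levyExponent γ σ ν u))

open scoped Topology ENNReal NNReal Nat

/-- The `n`-fold additive convolution power of a measure on `ℝ`. -/
noncomputable def convPow (ρ : Measure ℝ) : ℕ → Measure ℝ
  | 0 => Measure.dirac 0
  | n + 1 => ρ.conv (convPow ρ n)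

instance isFiniteMeasure_convPow (ρ : Measure ℝ) [IsFiniteMeasure ρ] (n : ℕ) :
    IsFiniteMeasure (convPow ρ n) := by
  induction n with
  | zero => unfold convPow; infer_instance
  | succ n ih => unfold convPow; infer_instance

theorem charFun_convPow (ρ : Measure ℝ) [IsFiniteMeasure ρ] (n : ℕ) (u : ℝ) :
    charFun (convPow ρ n) u = charFun ρ u ^ n := by
  induction n with
  | zero => simp [convPow, charFun_dirac]
  | succ n ih => rw [convPow, charFun_conv, ih, pow_succ']

theorem lintegral_exp_conv (q : ℝ) (ρ τ : Measure ℝ) [SFinite ρ] [SFinite τ] :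
    ∫⁻ x, ENNReal.ofReal (Real.exp (q * x)) ∂(ρ.conv τ) =
      (∫⁻ x, ENNReal.ofReal (Real.exp (q * x)) ∂ρ) *
        ∫⁻ x, ENNReal.ofReal (Real.exp (q * x)) ∂τ := by
  rw [Measure.lintegral_conv (by fun_prop), ← lintegral_mul_const _ (by fun_prop)]
  refine lintegral_congr fun x => ?_
  rw [← lintegral_const_mul _ (by fun_prop)]
  refine lintegral_congr fun y => ?_
  rw [mul_add, Real.exp_add, ENNReal.ofReal_mul (Real.exp_nonneg _)]

theorem lintegral_exp_convPow (q : ℝ) (ρ : Measure ℝ) [IsFiniteMeasure ρ] (n : ℕ) :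
    ∫⁻ x, ENNReal.ofReal (Real.exp (q * x)) ∂(convPow ρ n) =
      (∫⁻ x, ENNReal.ofReal (Real.exp (q * x)) ∂ρ) ^ n := by
  induction n with
  | zero => simp [convPow]
  | succ n ih => rw [convPow, lintegral_exp_conv, ih, pow_succ']

/-- The compound Poisson distribution with (finite) jump measure `ρ`. -/
noncomputable def compoundPoisson (ρ : Measure ℝ) : Measure ℝ :=
  ENNReal.ofReal (Real.exp (-ρ.real Set.univ)) •
    Measure.sum fun n : ℕ => ENNReal.ofReal ((n ! : ℝ)⁻¹) • convPow ρ n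

theorem lintegral_exp_compoundPoisson (q : ℝ) (ρ : Measure ℝ) [IsFiniteMeasure ρ]
    (h : Integrable (fun x => Real.exp (q * x)) ρ) :
    ∫⁻ x, ENNReal.ofReal (Real.exp (q * x)) ∂(compoundPoisson ρ) =
      ENNReal.ofReal (Real.exp (∫ x, (Real.exp (q * x) - 1) ∂ρ)) := by
  have hpos : 0 ≤ ∫ x, Real.exp (q * x) ∂ρ := integral_nonneg fun x => Real.exp_nonneg _
  have h1 : ∑' n : ℕ, ENNReal.ofReal ((n ! : ℝ)⁻¹) *
      (ENNReal.ofReal (∫ x, Real.exp (q * x) ∂ρ)) ^ n =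
      ENNReal.ofReal (Real.exp (∫ x, Real.exp (q * x) ∂ρ)) := by
    have hs := NormedSpace.expSeries_div_hasSum_exp (∫ x, Real.exp (q * x) ∂ρ)
    rw [← Real.exp_eq_exp_ℝ] at hs
    rw [← hs.tsum_eq, ENNReal.ofReal_tsum_of_nonneg (fun n => by positivity) hs.summable]
    refine tsum_congr fun n => ?_
    rw [← ENNReal.ofReal_pow hpos, ← ENNReal.ofReal_mul (by positivity), div_eq_inv_mul]
  rw [compoundPoisson, lintegral_smul_measure, lintegral_sum_measure]
  simp_rw [lintegral_smul_measure, lintegral_exp_convPow]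
  rw [← ofReal_integral_eq_lintegral_ofReal h (ae_of_all _ fun x => Real.exp_nonneg _)]
  simp only [smul_eq_mul]
  rw [h1, ← ENNReal.ofReal_mul (Real.exp_nonneg _), ← Real.exp_add,
    integral_sub h (integrable_const _), integral_const, smul_eq_mul, mul_one]
  congr 2
  ring

instance isProbabilityMeasure_compoundPoisson (ρ : Measure ℝ) [IsFiniteMeasure ρ] :
    IsProbabilityMeasure (compoundPoisson ρ) := by
  constructor
  simpa using lintegral_exp_compoundPoisson 0 ρ (by simp)

theorem charFun_compoundPoisson (ρ : Measure ℝ) [IsFiniteMeasure ρ] (u : ℝ) :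
    charFun (compoundPoisson ρ) u =
      Complex.exp (∫ x, (Complex.exp (Complex.I * u * x) - 1) ∂ρ) := by
  have hexp (τ : Measure ℝ) [IsFiniteMeasure τ] :
      Integrable (fun x : ℝ => Complex.exp (u * x * Complex.I)) τ := by
    refine Integrable.of_bound (by fun_prop) 1 (ae_of_all _ fun x => ?_)
    rw [show (u : ℂ) * x * Complex.I = ((u * x : ℝ) : ℂ) * Complex.I by push_cast; ring,
      Complex.norm_exp_ofReal_mul_I]
  have hfin : IsFiniteMeasure (Measure.sum fun n : ℕ =>
      ENNReal.ofReal ((n ! : ℝ)⁻¹) • convPow ρ n) := by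
    have h := measure_lt_top (compoundPoisson ρ) Set.univ
    rw [compoundPoisson, Measure.smul_apply, smul_eq_mul] at h
    refine ⟨(ENNReal.mul_lt_top_iff.mp h).elim And.right ?_⟩
    rintro (h | h)
    · exact absurd h (by simp [Real.exp_pos])
    · rw [h]; exact ENNReal.zero_lt_top
  have hs := hasSum_integral_measure (hexp (Measure.sum fun n : ℕ =>
      ENNReal.ofReal ((n ! : ℝ)⁻¹) • convPow ρ n))
  have hs2 := NormedSpace.expSeries_div_hasSum_exp (charFun ρ u)
  rw [← Complex.exp_eq_exp_ℂ] at hs2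
  have heq : ∫ x : ℝ, Complex.exp (u * x * Complex.I) ∂(Measure.sum fun n : ℕ =>
      ENNReal.ofReal ((n ! : ℝ)⁻¹) • convPow ρ n) = Complex.exp (charFun ρ u) := by
    have hterm : (fun n : ℕ => ∫ x : ℝ, Complex.exp (u * x * Complex.I)
        ∂(ENNReal.ofReal ((n ! : ℝ)⁻¹) • convPow ρ n)) = fun n => charFun ρ u ^ n / n ! := by
      funext n
      rw [integral_smul_measure, ← charFun_apply_real, charFun_convPow,
        ENNReal.toReal_ofReal (by positivity), div_eq_inv_mul, Complex.real_smul]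
      push_cast
      rfl
    rw [hterm] at hs
    exact hs.unique hs2
  rw [charFun_apply_real, compoundPoisson, integral_smul_measure, heq,
    ENNReal.toReal_ofReal (Real.exp_nonneg _), Complex.real_smul, Complex.ofReal_exp,
    ← Complex.exp_add]
  congr 1
  have h3 : ∀ x : ℝ, Complex.I * u * x = u * x * Complex.I := fun x => by ring
  simp_rw [h3]
  rw [integral_sub (hexp ρ) (integrable_const _), charFun_apply_real, integral_const]
  simp
  ring

theorem IsLevyMeasure.integrable_min {ν : Measure ℝ} (hν : IsLevyMeasure ν) :
    Integrable (fun x : ℝ => min (x ^ 2) 1) ν := by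
  refine ⟨by fun_prop, ?_⟩
  rw [hasFiniteIntegral_iff_ofReal (ae_of_all _ fun x => by positivity)]
  exact hν.2

theorem measurableSet_lt_abs (ε : ℝ) : MeasurableSet {x : ℝ | ε < |x|} :=
  measurableSet_lt measurable_const (by fun_prop)

theorem IsLevyMeasure.measure_lt_abs_lt_top {ν : Measure ℝ} (hν : IsLevyMeasure ν) {ε : ℝ}
    (hε : 0 < ε) : ν {x : ℝ | ε < |x|} < ⊤ := by
  refine (measure_mono ?_).trans_lt
    (hν.integrable_min.measure_ge_lt_top (ε := min (ε ^ 2) 1) (by positivity))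
  intro x hx
  have : ε ^ 2 ≤ x ^ 2 := by
    rw [← sq_abs x]
    exact pow_le_pow_left₀ hε.le (le_of_lt hx) 2
  exact min_le_min_right 1 this

/-- The compensated exponential `e^{zx} - 1 - z x 𝟙{|x| ≤ 1}`. -/
noncomputable def compensatedExp (z : ℂ) (x : ℝ) : ℂ :=
  Complex.exp (z * x) - 1 - z * ({y : ℝ | |y| ≤ 1}.indicator (fun y => (y : ℂ)) x)

theorem measurableSet_abs_le_one : MeasurableSet {y : ℝ | |y| ≤ 1} :=
  measurableSet_le (by fun_prop) measurable_const

theorem measurable_indicator_abs_le_one :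
    Measurable ({y : ℝ | |y| ≤ 1}.indicator (fun y => (y : ℂ))) :=
  Measurable.indicator (by fun_prop) measurableSet_abs_le_one

theorem measurable_compensatedExp (z : ℂ) : Measurable (compensatedExp z) := by
  unfold compensatedExp
  have := measurable_indicator_abs_le_one
  fun_prop

theorem integrable_compensatedExp {ν : Measure ℝ} (hν : IsLevyMeasure ν) (z : ℂ)
    (hz : IntegrableOn (fun x : ℝ => Real.exp (z.re * x)) {x : ℝ | 1 < |x|} ν) :
    Integrable (compensatedExp z) ν := by
  have hcover : {x : ℝ | |x| ≤ 1} ∪ {x : ℝ | 1 < |x|} = Set.univ := by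
    ext x; simpa using le_or_gt |x| 1
  rw [← integrableOn_univ, ← hcover]
  refine IntegrableOn.union ?_ ?_
  · refine Integrable.mono' ((hν.integrable_min.const_mul
      (‖z‖ ^ 2 * Real.exp ‖z‖)).integrableOn) (measurable_compensatedExp z).aestronglyMeasurable ?_
    refine (ae_restrict_iff' measurableSet_abs_le_one).mpr (ae_of_all _ fun x hx => ?_)
    have hx1 : |x| ≤ 1 := hx
    have h := Complex.norm_exp_sub_sum_le_norm_mul_exp (z * x) 2
    have h2 : compensatedExp z x =
        Complex.exp (z * x) - ∑ m ∈ Finset.range 2, (z * x) ^ m / (m.factorial : ℂ) := by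
      rw [compensatedExp, Set.indicator_of_mem hx]
      simp [Finset.sum_range_succ]
      ring
    rw [h2]
    refine h.trans ?_
    have hmin : min (x ^ 2) 1 = x ^ 2 := min_eq_left (by
      rw [← sq_abs]; exact pow_le_one₀ (abs_nonneg _) hx1)
    rw [hmin, norm_mul, Complex.norm_real, Real.norm_eq_abs, mul_pow, sq_abs]
    have : Real.exp (‖z‖ * |x|) ≤ Real.exp ‖z‖ :=
      Real.exp_le_exp.mpr (mul_le_of_le_one_right (norm_nonneg _) hx1)
    calc ‖z‖ ^ 2 * x ^ 2 * Real.exp (‖z‖ * |x|) ≤ ‖z‖ ^ 2 * x ^ 2 * Real.exp ‖z‖ := by gcongr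
      _ = _ := by ring
  · have hfin : ν {x : ℝ | 1 < |x|} ≠ ⊤ := (hν.measure_lt_abs_lt_top one_pos).ne
    refine Integrable.mono' (hz.add (integrableOn_const hfin (C := (1 : ℝ))))
      (measurable_compensatedExp z).aestronglyMeasurable ?_
    refine (ae_restrict_iff' (measurableSet_lt_abs 1)).mpr (ae_of_all _ fun x hx => ?_)
    rw [compensatedExp, Set.indicator_of_notMem (by simpa using hx)]
    simp only [mul_zero, sub_zero, Pi.add_apply]
    refine (norm_sub_le _ _).trans ?_
    simp [Complex.norm_exp]

theorem integrable_compensatedExp_I_mul {ν : Measure ℝ} (hν : IsLevyMeasure ν) (u : ℝ) :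
    Integrable (compensatedExp (Complex.I * u)) ν := by
  refine integrable_compensatedExp hν _ ?_
  simpa using (hν.measure_lt_abs_lt_top one_pos)

theorem levyExponent_eq (γ σ : ℝ) (ν : Measure ℝ) (u : ℝ) :
    levyExponent γ σ ν u = -Complex.I * γ * u + σ ^ 2 * u ^ 2 / 2 -
      ∫ x, compensatedExp (Complex.I * u) x ∂ν := rfl

/-- The Lévy measure scaled by `t` and with the jumps of size at most `ε` removed. -/
noncomputable def bigJumps (ν : Measure ℝ) (t ε : ℝ) : Measure ℝ :=
  ENNReal.ofReal t • ν.restrict {x : ℝ | ε < |x|}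

theorem isFiniteMeasure_bigJumps {ν : Measure ℝ} (hν : IsLevyMeasure ν) (t : ℝ) {ε : ℝ}
    (hε : 0 < ε) : IsFiniteMeasure (bigJumps ν t ε) := by
  have : IsFiniteMeasure (ν.restrict {x : ℝ | ε < |x|}) :=
    ⟨by simpa using hν.measure_lt_abs_lt_top hε⟩
  unfold bigJumps
  exact Measure.smul_finite _ ENNReal.ofReal_ne_top

theorem integral_bigJumps {E : Type*} [NormedAddCommGroup E] [NormedSpace ℝ E]
    (ν : Measure ℝ) {t : ℝ} (ht : 0 ≤ t) (ε : ℝ) (f : ℝ → E) :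
    ∫ x, f x ∂(bigJumps ν t ε) = t • ∫ x in {x : ℝ | ε < |x|}, f x ∂ν := by
  rw [bigJumps, integral_smul_measure, ENNReal.toReal_ofReal ht]

/-- The infinitely divisible law with triplet `(tγ, √t σ, tν)`, with the jumps of size at most
`ε` removed. -/
noncomputable def truncatedLaw (γ σ : ℝ) (ν : Measure ℝ) (t ε : ℝ) : Measure ℝ :=
  (gaussianReal (t * (γ - ∫ x in {x : ℝ | ε < |x|},
    {y : ℝ | |y| ≤ 1}.indicator (fun y => y) x ∂ν)) (Real.toNNReal (t * σ ^ 2))).conv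
    (compoundPoisson (bigJumps ν t ε))

theorem isProbabilityMeasure_truncatedLaw (γ σ : ℝ) {ν : Measure ℝ} (hν : IsLevyMeasure ν)
    (t : ℝ) {ε : ℝ} (hε : 0 < ε) : IsProbabilityMeasure (truncatedLaw γ σ ν t ε) := by
  have := isFiniteMeasure_bigJumps hν t hε
  unfold truncatedLaw
  infer_instance

theorem integrableOn_indicator_abs_le_one {ν : Measure ℝ} (hν : IsLevyMeasure ν) {ε : ℝ}
    (hε : 0 < ε) :
    IntegrableOn ({y : ℝ | |y| ≤ 1}.indicator (fun y => y)) {x : ℝ | ε < |x|} ν := by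
  refine Integrable.mono' (integrableOn_const (hν.measure_lt_abs_lt_top hε).ne (C := (1 : ℝ)))
    (Measurable.indicator measurable_id measurableSet_abs_le_one).aestronglyMeasurable
    (ae_of_all _ fun x => ?_)
  by_cases hx : x ∈ {y : ℝ | |y| ≤ 1}
  · rw [Set.indicator_of_mem hx]; exact hx
  · rw [Set.indicator_of_notMem hx]; simp

theorem setIntegral_compensatedExp {ν : Measure ℝ} (hν : IsLevyMeasure ν) {ε : ℝ} (hε : 0 < ε)
    {z : ℂ} (hz : Integrable (compensatedExp z) ν) :
    ∫ x in {x : ℝ | ε < |x|}, compensatedExp z x ∂ν =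
      ∫ x in {x : ℝ | ε < |x|}, (Complex.exp (z * x) - 1) ∂ν -
        z * ((∫ x in {x : ℝ | ε < |x|}, {y : ℝ | |y| ≤ 1}.indicator (fun y => y) x ∂ν : ℝ) : ℂ) := by
  have hind : IntegrableOn (fun x => (({y : ℝ | |y| ≤ 1}.indicator (fun y => y) x : ℝ) : ℂ))
      {x : ℝ | ε < |x|} ν := (integrableOn_indicator_abs_le_one hν hε).ofReal
  have hpt : ∀ x : ℝ, Complex.exp (z * x) - 1 = compensatedExp z x +
      z * (({y : ℝ | |y| ≤ 1}.indicator (fun y => y) x : ℝ) : ℂ) := by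
    intro x
    rw [compensatedExp]
    by_cases hx : x ∈ {y : ℝ | |y| ≤ 1}
    · rw [Set.indicator_of_mem hx, Set.indicator_of_mem hx]; ring
    · rw [Set.indicator_of_notMem hx, Set.indicator_of_notMem hx]; simp
  simp only [hpt]
  have hadd := integral_add (hz.integrableOn (s := {x : ℝ | ε < |x|})) (hind.const_mul z)
  rw [integral_const_mul] at hadd
  have : ∫ x in {x : ℝ | ε < |x|}, (({y : ℝ | |y| ≤ 1}.indicator (fun y => y) x : ℝ) : ℂ) ∂ν
    = ((∫ x in {x : ℝ | ε < |x|}, {y : ℝ | |y| ≤ 1}.indicator (fun y => y) x ∂ν : ℝ) : ℂ) :=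
    integral_ofReal
  rw [this] at hadd
  exact eq_sub_of_add_eq hadd.symm

theorem charFun_truncatedLaw (γ σ : ℝ) {ν : Measure ℝ} (hν : IsLevyMeasure ν) {t : ℝ}
    (ht : 0 ≤ t) {ε : ℝ} (hε : 0 < ε) (u : ℝ) :
    charFun (truncatedLaw γ σ ν t ε) u = Complex.exp (-(t : ℂ) *
      (-Complex.I * γ * u + σ ^ 2 * u ^ 2 / 2 -
        ∫ x in {x : ℝ | ε < |x|}, compensatedExp (Complex.I * u) x ∂ν)) := by
  have := isFiniteMeasure_bigJumps hν t hε
  rw [truncatedLaw, charFun_conv, charFun_gaussianReal, charFun_compoundPoisson,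
    ← Complex.exp_add, integral_bigJumps ν ht,
    setIntegral_compensatedExp hν hε (integrable_compensatedExp_I_mul hν u), Complex.real_smul,
    Real.coe_toNNReal _ (by positivity)]
  congr 1
  push_cast
  ring

theorem lintegral_exp_truncatedLaw_le (γ σ : ℝ) {ν : Measure ℝ} (hν : IsLevyMeasure ν) {t : ℝ}
    (ht : 0 ≤ t) {ε : ℝ} (hε : 0 < ε) {q : ℝ}
    (hq : IntegrableOn (fun x : ℝ => Real.exp (q * x)) {x : ℝ | 1 < |x|} ν) :
    ∫⁻ x, ENNReal.ofReal (Real.exp (q * x)) ∂(truncatedLaw γ σ ν t ε) ≤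
      ENNReal.ofReal (Real.exp (t * (γ * q + σ ^ 2 * q ^ 2 / 2 +
        ∫ x, ‖compensatedExp q x‖ ∂ν))) := by
  have := isFiniteMeasure_bigJumps hν t hε
  have hz : Integrable (compensatedExp q) ν := integrable_compensatedExp hν _ (by simpa using hq)
  have hind : IntegrableOn (fun x => (({y : ℝ | |y| ≤ 1}.indicator (fun y => y) x : ℝ) : ℂ))
      {x : ℝ | ε < |x|} ν := (integrableOn_indicator_abs_le_one hν hε).ofReal
  have hexpC : IntegrableOn (fun x : ℝ => Complex.exp (q * x)) {x : ℝ | ε < |x|} ν := by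
    have h := (hz.integrableOn (s := {x : ℝ | ε < |x|})).add ((hind.const_mul (q : ℂ)).add
      (integrableOn_const (hν.measure_lt_abs_lt_top hε).ne (C := (1 : ℂ))))
    refine h.congr (ae_of_all _ fun x => ?_)
    simp only [Pi.add_apply, compensatedExp]
    by_cases hx : x ∈ {y : ℝ | |y| ≤ 1}
    · rw [Set.indicator_of_mem hx, Set.indicator_of_mem hx]
      ring
    · rw [Set.indicator_of_notMem hx, Set.indicator_of_notMem hx]; simp
  have hexp : IntegrableOn (fun x : ℝ => Real.exp (q * x)) {x : ℝ | ε < |x|} ν := by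
    refine hexpC.re.congr (ae_of_all _ fun x => ?_)
    simp [← Complex.ofReal_mul, ← Complex.ofReal_exp]
  have hexp' : Integrable (fun x : ℝ => Real.exp (q * x)) (bigJumps ν t ε) :=
    hexp.smul_measure ENNReal.ofReal_ne_top
  have hgauss := mgf_gaussianReal (p := gaussianReal (t * (γ - ∫ x in {x : ℝ | ε < |x|},
    {y : ℝ | |y| ≤ 1}.indicator (fun y => y) x ∂ν)) (Real.toNNReal (t * σ ^ 2)))
    (X := id) Measure.map_id q
  rw [mgf] at hgauss
  rw [truncatedLaw, lintegral_exp_conv, lintegral_exp_compoundPoisson q _ hexp',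
    ← ofReal_integral_eq_lintegral_ofReal (integrable_exp_mul_gaussianReal q)
      (ae_of_all _ fun x => Real.exp_nonneg _)]
  simp only [id] at hgauss
  rw [hgauss, ← ENNReal.ofReal_mul (Real.exp_nonneg _), ← Real.exp_add]
  refine ENNReal.ofReal_le_ofReal (Real.exp_le_exp.mpr ?_)
  rw [integral_bigJumps ν ht, Real.coe_toNNReal _ (by positivity), smul_eq_mul]
  have hC := setIntegral_compensatedExp hν hε hz
  have hcast : ∫ x in {x : ℝ | ε < |x|}, (Complex.exp (q * x) - 1) ∂ν =
      ((∫ x in {x : ℝ | ε < |x|}, (Real.exp (q * x) - 1) ∂ν : ℝ) : ℂ) := by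
    rw [← integral_complex_ofReal]
    simp
  rw [hcast] at hC
  have hle : ‖∫ x in {x : ℝ | ε < |x|}, compensatedExp q x ∂ν‖ ≤ ∫ x, ‖compensatedExp q x‖ ∂ν :=
    (norm_integral_le_integral_norm _).trans
      (setIntegral_le_integral hz.norm (ae_of_all _ fun x => norm_nonneg _))
  rw [hC, ← Complex.ofReal_mul, ← Complex.ofReal_sub, Complex.norm_real] at hle
  have := mul_le_mul_of_nonneg_left ((Real.le_norm_self _).trans hle) ht
  linarith

theorem lintegral_exp_lt_top_of_charFun (γ σ : ℝ) {ν : Measure ℝ} (hν : IsLevyMeasure ν) {t : ℝ}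
    (ht : 0 ≤ t) {q : ℝ} (hq : IntegrableOn (fun x : ℝ => Real.exp (q * x)) {x : ℝ | 1 < |x|} ν)
    (P : Measure ℝ) [IsProbabilityMeasure P]
    (hP : ∀ u : ℝ, charFun P u = Complex.exp (-(t : ℂ) * levyExponent γ σ ν u)) :
    ∫⁻ x, ENNReal.ofReal (Real.exp (q * x)) ∂P < ⊤ := by
  have hε : ∀ n : ℕ, (0 : ℝ) < 1 / ((n : ℝ) + 1) := fun n => by positivity
  have hprob : ∀ n : ℕ, IsProbabilityMeasure (truncatedLaw γ σ ν t (1 / ((n : ℝ) + 1))) :=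
    fun n => isProbabilityMeasure_truncatedLaw γ σ hν t (hε n)
  have hUnion : ⋃ n : ℕ, {x : ℝ | 1 / ((n : ℝ) + 1) < |x|} = {0}ᶜ := by
    ext x
    simp only [Set.mem_iUnion, Set.mem_ofPred_eq, Set.mem_compl_iff, Set.mem_singleton_iff]
    constructor
    · rintro ⟨n, hn⟩ rfl
      rw [abs_zero] at hn
      exact (hε n).not_gt hn
    · exact fun hx => exists_nat_one_div_lt (abs_pos.mpr hx)
  have hlim : ∀ u : ℝ, Tendsto (fun n : ℕ => charFun (truncatedLaw γ σ ν t (1 / ((n : ℝ) + 1))) u)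
      atTop (𝓝 (charFun P u)) := by
    intro u
    simp_rw [charFun_truncatedLaw γ σ hν ht (hε _), hP, levyExponent_eq]
    have hI := integrable_compensatedExp_I_mul hν u
    have hmono : Monotone fun n : ℕ => {x : ℝ | 1 / ((n : ℝ) + 1) < |x|} := fun m n hmn x hx => by
      rw [Set.mem_ofPred_eq] at hx ⊢
      exact (one_div_le_one_div_of_le (by positivity) (by gcongr)).trans_lt hx
    have h := tendsto_setIntegral_of_monotone (μ := ν)
      (s := fun n : ℕ => {x : ℝ | 1 / ((n : ℝ) + 1) < |x|})
      (fun n => measurableSet_lt_abs _) hmono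
      (hI.integrableOn)
    rw [hUnion, setIntegral_congr_set (t := Set.univ)
      (by rw [ae_eq_univ, compl_compl]; exact hν.1), setIntegral_univ] at h
    exact ((Complex.continuous_exp.tendsto _).comp ((h.const_sub _).const_mul _))
  have hweak := ProbabilityMeasure.tendsto_of_tendsto_charFun
    (μ := fun n : ℕ => (⟨truncatedLaw γ σ ν t (1 / ((n : ℝ) + 1)), hprob n⟩ : ProbabilityMeasure ℝ))
    (μ₀ := ⟨P, inferInstance⟩) hlim
  have hliminf := lintegral_le_liminf_lintegral_of_forall_isOpen_measure_le_liminf_measure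
    (μ := P) (μs := fun n : ℕ => truncatedLaw γ σ ν t (1 / ((n : ℝ) + 1)))
    (f := fun x => Real.exp (q * x)) (by fun_prop) (fun x => Real.exp_nonneg _)
    (fun G hG => ProbabilityMeasure.le_liminf_measure_open_of_tendsto hweak hG)
  refine (hliminf.trans ?_).trans_lt (ENNReal.ofReal_lt_top (r := Real.exp (t * (γ * q +
    σ ^ 2 * q ^ 2 / 2 + ∫ x, ‖compensatedExp q x‖ ∂ν))))
  exact (liminf_le_liminf (Eventually.of_forall fun n =>
    lintegral_exp_truncatedLaw_le γ σ hν ht (hε n) hq)).trans_eq (liminf_const _)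

section IndependentIncrements

variable {Ω : Type*} {m0 : MeasurableSpace Ω} {μ : Measure Ω}

theorem indep_sup_left_of_indep [IsProbabilityMeasure μ] {m m₁ m₂ m' : MeasurableSpace Ω}
    (hm' : m' ≤ m0) (hm₂ : m₂ ≤ m0) (h₁ : Indep m₁ m μ) (h₂ : Indep m₂ m' μ)
    (hle₁ : m₁ ≤ m') (hle : m ≤ m') : Indep (m₁ ⊔ m₂) m μ := by
  refine IndepSets.indep (p1 := Set.image2 (· ∩ ·) {s | MeasurableSet[m₁] s}
    {s | MeasurableSet[m₂] s}) (p2 := {s | MeasurableSet[m] s})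
    (sup_le (hle₁.trans hm') hm₂) (hle.trans hm') ?_
    (@MeasurableSpace.isPiSystem_measurableSet Ω m) ?_
    (@MeasurableSpace.generateFrom_measurableSet Ω m).symm ?_
  · rintro _ ⟨a, ha, b, hb, rfl⟩ _ ⟨c, hc, d, hd, rfl⟩ -
    exact ⟨a ∩ c, MeasurableSet.inter ha hc, b ∩ d, MeasurableSet.inter hb hd,
      Set.inter_inter_inter_comm ..⟩
  · refine le_antisymm (sup_le ?_ ?_) (MeasurableSpace.generateFrom_le ?_)
    · exact fun s hs => MeasurableSpace.measurableSet_generateFrom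
        ⟨s, hs, Set.univ, MeasurableSet.univ, Set.inter_univ s⟩
    · exact fun s hs => MeasurableSpace.measurableSet_generateFrom
        ⟨Set.univ, MeasurableSet.univ, s, hs, Set.univ_inter s⟩
    · rintro _ ⟨a, ha, b, hb, rfl⟩
      exact MeasurableSet.inter (le_sup_left (a := m₁) (b := m₂) _ ha)
        (le_sup_right (a := m₁) (b := m₂) _ hb)
  · rw [IndepSets_iff]
    rintro _ c ⟨a, ha, b, hb, rfl⟩ hc
    rw [Indep_iff] at h₁ h₂
    change μ (a ∩ b ∩ c) = μ (a ∩ b) * μ c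
    have e : a ∩ b ∩ c = b ∩ (a ∩ c) := by
      rw [Set.inter_comm a b, Set.inter_assoc]
    rw [e, h₂ b (a ∩ c) hb (MeasurableSet.inter (hle₁ _ ha) (hle _ hc)), h₁ a c ha hc,
      Set.inter_comm, h₂ b a hb (hle₁ _ ha)]
    ring

/-- The σ-algebra generated by the increment of `X` between `s` and `t`. -/
@[reducible]
def incrementSigma (X : ℝ → Ω → ℝ) (s t : ℝ) : MeasurableSpace Ω :=
  MeasurableSpace.comap (fun ω => X t ω - X s ω) inferInstance

/-- The σ-algebra generated by the increments of `X` after time `a`. -/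
@[reducible]
def futureSigma (X : ℝ → Ω → ℝ) (a : ℝ) : MeasurableSpace Ω :=
  ⨆ v : Set.Ici a, incrementSigma X a v

variable {X : ℝ → Ω → ℝ} {ℱ : Filtration ℝ m0}

theorem incrementSigma_le (hX : Adapted ℱ X) {s t : ℝ} (hst : s ≤ t) :
    incrementSigma X s t ≤ ℱ t :=
  Measurable.comap_le ((hX t).sub ((hX s).mono (ℱ.mono hst) le_rfl))

theorem futureSigma_le (hX : Adapted ℱ X) (a : ℝ) : futureSigma X a ≤ m0 :=
  iSup_le fun v => (incrementSigma_le hX v.2).trans (ℱ.le _)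

theorem measurable_futureSigma_sub {a u v : ℝ} (hu : a ≤ u) (hv : a ≤ v) :
    Measurable[futureSigma X a] fun ω => X v ω - X u ω := by
  have h : ∀ w, a ≤ w → Measurable[futureSigma X a] fun ω => X w ω - X a ω := fun w hw =>
    (comap_measurable _).mono (le_iSup (fun v : Set.Ici a => incrementSigma X a v) ⟨w, hw⟩) le_rfl
  convert (h v hv).sub (h u hu) using 1
  ext ω
  simp

theorem futureSigma_antitone : Antitone (futureSigma X) := fun _ _ hab =>
  iSup_le fun v => Measurable.comap_le (measurable_futureSigma_sub hab (hab.trans v.2))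

theorem indep_biSup_incrementSigma [IsProbabilityMeasure μ] (hX : Adapted ℱ X)
    (hindep : ∀ s t : ℝ, 0 ≤ s → s ≤ t → Indep (incrementSigma X s t) (ℱ s) μ)
    (S : Finset ℝ) : ∀ a : ℝ, 0 ≤ a → (∀ v ∈ S, a ≤ v) →
    Indep (⨆ v ∈ S, incrementSigma X a v) (ℱ a) μ := by
  refine Finset.induction_on_min S (fun a _ _ => ?_) (fun b S hb ih a ha hS => ?_)
  · simpa using indep_bot_left (ℱ a)
  · classical
    have hab : a ≤ b := hS b (Finset.mem_insert_self _ _)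
    have h := indep_sup_left_of_indep (ℱ.le b)
      (iSup₂_le fun v hv => (incrementSigma_le hX (hb v hv).le).trans (ℱ.le v))
      (hindep a b ha hab) (ih b (ha.trans hab) fun v hv => (hb v hv).le)
      (incrementSigma_le hX hab) (ℱ.mono hab)
    refine indep_of_indep_of_le_left h (iSup₂_le fun v hv => ?_)
    rcases Finset.mem_insert.mp hv with rfl | hv
    · exact le_sup_left
    · have h1 : Measurable[incrementSigma X a b ⊔ ⨆ v ∈ S, incrementSigma X b v]
          fun ω => X b ω - X a ω := (comap_measurable _).mono le_sup_left le_rfl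
      have h2 : Measurable[incrementSigma X a b ⊔ ⨆ v ∈ S, incrementSigma X b v]
          fun ω => X v ω - X b ω := (comap_measurable _).mono
            ((le_iSup₂ (f := fun v (_ : v ∈ S) => incrementSigma X b v) v hv).trans le_sup_right)
            le_rfl
      refine Measurable.comap_le ?_
      convert h2.add h1 using 1
      ext ω
      simp

theorem indep_futureSigma [IsProbabilityMeasure μ] (hX : Adapted ℱ X)
    (hindep : ∀ s t : ℝ, 0 ≤ s → s ≤ t → Indep (incrementSigma X s t) (ℱ s) μ)
    {a : ℝ} (ha : 0 ≤ a) : Indep (futureSigma X a) (ℱ a) μ := by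
  have h := indep_iSup_of_directed_le (μ := μ)
    (m := fun S : {S : Finset ℝ // ∀ v ∈ S, a ≤ v} => ⨆ v ∈ S.1, incrementSigma X a v)
    (m1 := ℱ a)
    (fun S => indep_biSup_incrementSigma hX hindep S.1 a ha S.2)
    (fun S => iSup₂_le fun v hv => (incrementSigma_le hX (S.2 v hv)).trans (ℱ.le v)) (ℱ.le a)
    (fun S S' => ⟨⟨S.1 ∪ S'.1, fun v hv => (Finset.mem_union.mp hv).elim (S.2 v) (S'.2 v)⟩,
      biSup_mono fun v hv => Finset.mem_union_left _ hv,
      biSup_mono fun v hv => Finset.mem_union_right _ hv⟩)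
  refine indep_of_indep_of_le_left h (iSup_le fun v => ?_)
  refine le_trans ?_ (le_iSup _ ⟨{v.1}, fun w hw => by
    rw [Finset.mem_singleton.mp hw]; exact v.2⟩)
  simp

/-- Ottaviani's inequality, for a nondecreasing sequence of σ-algebras. -/
theorem mul_measure_biUnion_le {m : ℕ → MeasurableSpace Ω} (hm : ∀ k, m k ≤ m0) (hmono : Monotone m)
    {n : ℕ} {A F : ℕ → Set Ω} {B : Set Ω} {p : ENNReal}
    (hA : ∀ k, MeasurableSet[m k] (A k)) (hF : ∀ k, MeasurableSet (F k))
    (hAF : ∀ k ≤ n, ∀ E, MeasurableSet[m k] E → μ (E ∩ F k) = μ E * μ (F k))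
    (hp : ∀ k ≤ n, p ≤ μ (F k)) (hB : ∀ k ≤ n, A k ∩ F k ⊆ B) :
    p * μ (⋃ k ∈ Finset.range (n + 1), A k) ≤ μ B := by
  have hD : ∀ k, MeasurableSet[m k] (disjointed A k) := fun k => by
    rw [disjointed_eq_inter_compl]
    exact MeasurableSet.inter (hA k) (MeasurableSet.biInter (Set.to_countable _) fun j hj =>
      MeasurableSet.compl (hmono (le_of_lt hj) _ (hA j)))
  have hdisj := disjoint_disjointed A
  have hU : ⋃ k ∈ Finset.range (n + 1), A k = ⋃ k ∈ Finset.range (n + 1), disjointed A k := by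
    rw [biUnion_range_succ_disjointed, partialSups_eq_biSup]
    simp
  rw [hU, measure_biUnion_finset
    (fun i _ j _ hij => hdisj hij) (fun k _ => hm k _ (hD k)), Finset.mul_sum]
  calc ∑ k ∈ Finset.range (n + 1), p * μ (disjointed A k)
      ≤ ∑ k ∈ Finset.range (n + 1), μ (disjointed A k ∩ F k) := by
        refine Finset.sum_le_sum fun k hk => ?_
        have hk' : k ≤ n := Nat.lt_succ_iff.mp (Finset.mem_range.mp hk)
        rw [hAF k hk' _ (hD k), mul_comm]
        gcongr
        exact hp k hk'
    _ = μ (⋃ k ∈ Finset.range (n + 1), disjointed A k ∩ F k) := by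
        rw [measure_biUnion_finset
          (fun i _ j _ hij => (hdisj hij).mono Set.inter_subset_left Set.inter_subset_left)
          (fun k _ => (hm k _ (hD k)).inter (hF k))]
    _ ≤ μ B := by
        refine measure_mono (Set.iUnion₂_subset fun k hk => ?_)
        exact (Set.inter_subset_inter_left _ (disjointed_subset A k)).trans
          (hB k (Nat.lt_succ_iff.mp (Finset.mem_range.mp hk)))

end IndependentIncrements

theorem mul_lintegral_exp_le_of_measure_lt_le {Ω : Type*} {m0 : MeasurableSpace Ω} {μ : Measure Ω}
    {q : ℝ} (hq : 0 < q) {U V : Ω → ℝ} (hU : Measurable U) (hV : Measurable V) (c : ℝ≥0∞)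
    (h : ∀ y : ℝ, c * μ {ω | y < U ω} ≤ μ {ω | y < V ω}) :
    c * ∫⁻ ω, ENNReal.ofReal (Real.exp (q * U ω)) ∂μ ≤
      ∫⁻ ω, ENNReal.ofReal (Real.exp (q * V ω)) ∂μ := by
  have key : ∀ (W : Ω → ℝ) (t : ℝ), 0 < t →
      {ω | t < Real.exp (q * W ω)} = {ω | Real.log t / q < W ω} := fun W t ht => by
    ext ω
    rw [Set.mem_ofPred_eq, Set.mem_ofPred_eq, ← Real.log_lt_iff_lt_exp ht, div_lt_iff₀' hq]
  have hmeas : Measurable fun t : ℝ => μ {ω | t < Real.exp (q * U ω)} :=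
    (Antitone.measurable fun s t hst => measure_mono fun ω (hω : t < _) => hst.trans_lt hω)
  rw [lintegral_eq_lintegral_meas_lt μ (ae_of_all _ fun ω => Real.exp_nonneg _) (by fun_prop),
    lintegral_eq_lintegral_meas_lt μ (ae_of_all _ fun ω => Real.exp_nonneg _) (by fun_prop),
    ← lintegral_const_mul _ hmeas]
  refine setLIntegral_mono' measurableSet_Ioi fun t ht => ?_
  rw [key U t ht, key V t ht]
  exact h _

section LevyProcess

variable {Ω : Type*} {m0 : MeasurableSpace Ω} {μ : Measure Ω} {ℱ : Filtration ℝ m0}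
  {X : ℝ → Ω → ℝ} {γ σ : ℝ} {ν : Measure ℝ}

theorem IsLevyProcess.measurable (hX : IsLevyProcess μ ℱ X γ σ ν) (t : ℝ) : Measurable (X t) :=
  (hX.1 t).mono (ℱ.le t) le_rfl

theorem IsLevyProcess.indep_incrementSigma (hX : IsLevyProcess μ ℱ X γ σ ν) {s t : ℝ}
    (hs : 0 ≤ s) (hst : s ≤ t) : Indep (incrementSigma X s t) (ℱ s) μ :=
  hX.2.2.2.1 s t hs hst

theorem IsLevyProcess.measure_increment (hX : IsLevyProcess μ ℱ X γ σ ν) {s t : ℝ}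
    (hs : 0 ≤ s) (hst : s ≤ t) (y : ℝ) :
    μ {ω | y ≤ X t ω - X s ω} = μ {ω | y ≤ X (t - s) ω} := by
  have h := congrArg (fun P : Measure ℝ => P (Set.Ici y)) (hX.2.2.2.2.1 s t hs hst)
  change μ.map _ (Set.Ici y) = μ.map _ (Set.Ici y) at h
  have hm : Measurable fun ω => X t ω - X s ω := (hX.measurable t).sub (hX.measurable s)
  rwa [Measure.map_apply hm measurableSet_Ici,
    Measure.map_apply (hX.measurable _) measurableSet_Ici] at h

theorem IsLevyProcess.lintegral_exp_lt_top [IsProbabilityMeasure μ]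
    (hX : IsLevyProcess μ ℱ X γ σ ν) (hν : IsLevyMeasure ν) {t : ℝ} (ht : 0 ≤ t) {q : ℝ}
    (hq : IntegrableOn (fun x : ℝ => Real.exp (q * x)) {x : ℝ | 1 < |x|} ν) :
    ∫⁻ ω, ENNReal.ofReal (Real.exp (q * X t ω)) ∂μ < ⊤ := by
  have hprob : IsProbabilityMeasure (μ.map (X t)) :=
    Measure.isProbabilityMeasure_map (hX.measurable t).aemeasurable
  have h := lintegral_exp_lt_top_of_charFun γ σ hν ht hq (μ.map (X t)) fun u => by
    rw [← hX.2.2.2.2.2 t ht u, charFun_apply_real, integral_map (hX.measurable t).aemeasurable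
      (by fun_prop)]
    refine integral_congr_ae (ae_of_all _ fun ω => ?_)
    simp only
    congr 1
    ring
  rwa [lintegral_map (by fun_prop) (hX.measurable t)] at h

theorem IsLevyProcess.exists_half_le_measure [IsProbabilityMeasure μ]
    (hX : IsLevyProcess μ ℱ X γ σ ν) :
    ∃ δ : ℝ, 0 < δ ∧ ∀ s, 0 ≤ s → s ≤ δ → 2⁻¹ ≤ μ {ω | -1 ≤ X s ω} := by
  by_contra! hcon
  choose s hs0 hs1 hs2 using fun n : ℕ => hcon (1 / ((n : ℝ) + 1)) (by positivity)
  have hs : Tendsto s atTop (𝓝[≥] 0) := by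
    refine tendsto_nhdsWithin_iff.mpr ⟨?_, Eventually.of_forall hs0⟩
    exact squeeze_zero hs0 hs1 tendsto_one_div_add_atTop_nhds_zero_nat
  have hlim : TendstoInMeasure μ (fun n => X (s n)) atTop (fun _ => 0) :=
    tendstoInMeasure_of_tendsto_ae (fun n => (hX.measurable _).aestronglyMeasurable)
      (ae_of_all _ fun ω => by
        have := (hX.2.2.1 ω 0).tendsto.comp hs
        rwa [hX.2.1 ω] at this)
  rw [tendstoInMeasure_iff_norm] at hlim
  obtain ⟨n, hn⟩ := ((hlim 1 one_pos).eventually_lt_const (u := 2⁻¹) (by simp)).exists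
  have hcov : (Set.univ : Set Ω) ⊆ {ω | -1 ≤ X (s n) ω} ∪ {ω | 1 ≤ ‖X (s n) ω - 0‖} := by
    intro ω _
    by_cases h : -1 ≤ X (s n) ω
    · exact Or.inl h
    · right
      rw [Set.mem_ofPred_eq, sub_zero, Real.norm_eq_abs]
      push Not at h
      linarith [neg_le_abs (X (s n) ω)]
  have h1 := (measure_mono hcov).trans (measure_union_le (μ := μ) _ _)
  rw [measure_univ] at h1
  have h2 := ENNReal.add_lt_add (hs2 n) hn
  rw [ENNReal.inv_two_add_inv_two] at h2
  exact absurd h1 (not_le.mpr h2)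

theorem IsLevyProcess.exists_le_measure [IsProbabilityMeasure μ]
    (hX : IsLevyProcess μ ℱ X γ σ ν) (T : ℝ) :
    ∃ p : ℝ≥0∞, p ≠ 0 ∧ ∃ K : ℝ, ∀ r s, 0 ≤ r → r ≤ s → s ≤ T →
      p ≤ μ {ω | -K ≤ X s ω - X r ω} := by
  obtain ⟨δ, hδ, h⟩ := hX.exists_half_le_measure
  have hind : ∀ N : ℕ, ∀ s, 0 ≤ s → s ≤ N * δ → (2⁻¹ : ℝ≥0∞) ^ N ≤ μ {ω | -(N : ℝ) ≤ X s ω} := by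
    intro N
    induction N with
    | zero =>
      intro s hs0 hs1
      have hs : s = 0 := le_antisymm (by simpa using hs1) hs0
      subst hs
      simp [hX.2.1]
    | succ N ih =>
      intro s hs0 hs1
      push_cast at hs1
      have hr0 : 0 ≤ max (s - δ) 0 := le_max_right _ _
      have hrs : max (s - δ) 0 ≤ s := max_le (by linarith) hs0
      have hrN : max (s - δ) 0 ≤ N * δ := max_le (by linarith) (by positivity)
      generalize hr : max (s - δ) 0 = r at hr0 hrs hrN
      have hsr : s - r ≤ δ := by rw [← hr]; linarith [le_max_left (s - δ) 0]
      have hI := (Indep_iff _ _ μ).mp (hX.indep_incrementSigma hr0 hrs)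
        {ω | -1 ≤ X s ω - X r ω} {ω | -(N : ℝ) ≤ X r ω}
        ⟨Set.Ici (-1), measurableSet_Ici, rfl⟩ (hX.1 r measurableSet_Ici)
      rw [hX.measure_increment hr0 hrs] at hI
      calc (2⁻¹ : ℝ≥0∞) ^ (N + 1) = 2⁻¹ * 2⁻¹ ^ N := pow_succ' _ _
        _ ≤ _ * _ := mul_le_mul' (h (s - r) (by linarith) hsr) (ih r hr0 hrN)
        _ = _ := hI.symm
        _ ≤ _ := measure_mono fun ω hω => by
          have h1 : -1 ≤ X s ω - X r ω := hω.1
          have h2 : -(N : ℝ) ≤ X r ω := hω.2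
          rw [Set.mem_ofPred_eq]
          push_cast
          linarith
  obtain ⟨N, hN⟩ := exists_nat_ge (T / δ)
  refine ⟨2⁻¹ ^ N, pow_ne_zero _ (by simp), N, fun r s hr hrs hs => ?_⟩
  rw [hX.measure_increment hr hrs]
  refine hind N _ (by linarith) ?_
  rw [div_le_iff₀ hδ] at hN
  linarith

theorem IsLevyProcess.mul_measure_iUnion_lt_le [IsProbabilityMeasure μ]
    (hX : IsLevyProcess μ ℱ X γ σ ν) {T K : ℝ} {p : ℝ≥0∞}
    (hp : ∀ r s, 0 ≤ r → r ≤ s → s ≤ T → p ≤ μ {ω | -K ≤ X s ω - X r ω})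
    {t : ℕ → ℝ} (ht : Monotone t) (ht0 : 0 ≤ t 0) (htT : ∀ k, t k ≤ T) (n : ℕ) (y : ℝ) :
    p * p * μ (⋃ k ∈ Finset.range (n + 1), ⋃ i ∈ Finset.range (k + 1),
      {ω | y + 2 * K < X (t k) ω - X (t i) ω}) ≤ μ {ω | y < X (t n) ω - X (t 0) ω} := by
  have htn : ∀ k, 0 ≤ t k := fun k => ht0.trans (ht (Nat.zero_le k))
  have h1 := mul_measure_biUnion_le (μ := μ) (m := fun k => ℱ (t k)) (fun k => ℱ.le _)
    (fun i j hij => ℱ.mono (ht hij)) (n := n) (p := p)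
    (A := fun k => ⋃ i ∈ Finset.range (k + 1), {ω | y + 2 * K < X (t k) ω - X (t i) ω})
    (F := fun k => {ω | -K ≤ X (t n) ω - X (t k) ω})
    (B := ⋃ i ∈ Finset.range (n + 1), {ω | y + K < X (t n) ω - X (t i) ω})
    (fun k => Finset.measurableSet_biUnion _ fun i hi => by
      have hik : t i ≤ t k := ht (Nat.lt_succ_iff.mp (Finset.mem_range.mp hi))
      exact ((hX.1 (t k)).sub ((hX.1 (t i)).mono (ℱ.mono hik) le_rfl)) measurableSet_Ioi)
    (fun k => ((hX.measurable _).sub (hX.measurable _)) measurableSet_Ici)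
    (fun k hk E hE => by
      rw [Set.inter_comm, mul_comm]
      exact (Indep_iff _ _ μ).mp (hX.indep_incrementSigma (htn k) (ht hk)) _ E
        ⟨Set.Ici (-K), measurableSet_Ici, rfl⟩ hE)
    (fun k hk => hp _ _ (htn k) (ht hk) (htT n))
    (fun k hk ω hω => by
      obtain ⟨hω1, hω2⟩ := hω
      simp only [Set.mem_iUnion, Finset.mem_range, Set.mem_ofPred_eq] at hω1 hω2 ⊢
      obtain ⟨i, hi, h⟩ := hω1
      exact ⟨i, by omega, by linarith⟩)
  have h2 := mul_measure_biUnion_le (μ := μ) (m := fun k => futureSigma X (t (n - k)))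
    (fun k => futureSigma_le hX.1 _)
    (fun i j hij => futureSigma_antitone (ht (by omega))) (n := n) (p := p)
    (A := fun k => {ω | y + K < X (t n) ω - X (t (n - k)) ω})
    (F := fun k => {ω | -K ≤ X (t (n - k)) ω - X (t 0) ω})
    (B := {ω | y < X (t n) ω - X (t 0) ω})
    (fun k => measurable_futureSigma_sub le_rfl (ht (Nat.sub_le n k)) measurableSet_Ioi)
    (fun k => ((hX.measurable _).sub (hX.measurable _)) measurableSet_Ici)
    (fun k hk E hE => by
      have hF : Measurable[ℱ (t (n - k))] fun ω => X (t (n - k)) ω - X (t 0) ω :=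
        (hX.1 (t (n - k))).sub ((hX.1 (t 0)).mono (ℱ.mono (ht (Nat.zero_le _))) le_rfl)
      exact (Indep_iff _ _ μ).mp (indep_futureSigma hX.1
        (fun s t hs hst => hX.indep_incrementSigma hs hst) (htn (n - k))) E _ hE
        (hF measurableSet_Ici))
    (fun k hk => hp _ _ ht0 (ht (Nat.zero_le _)) (htT _))
    (fun k hk ω hω => by
      obtain ⟨hω1, hω2⟩ := hω
      simp only [Set.mem_ofPred_eq] at hω1 hω2 ⊢
      linarith)
  rw [mul_assoc]
  refine (mul_le_mul_right h1 p).trans (le_trans (mul_le_mul_right (measure_mono ?_) p) h2)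
  refine Set.iUnion₂_subset fun i hi => ?_
  have hi' : i ≤ n := Nat.lt_succ_iff.mp (Finset.mem_range.mp hi)
  refine Set.subset_iUnion₂_of_subset (n - i) (Finset.mem_range.mpr (by omega)) ?_
  rw [Nat.sub_sub_self hi']

/-- The largest increment of the finite sequence `x 0, …, x n`. -/
noncomputable def maxIncrement (x : ℕ → ℝ) (n : ℕ) : ℝ :=
  (Finset.range (n + 1)).sup' Finset.nonempty_range_add_one fun k =>
    (Finset.range (k + 1)).sup' Finset.nonempty_range_add_one fun i => x k - x i

theorem lt_maxIncrement_iff {x : ℕ → ℝ} {n : ℕ} {y : ℝ} :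
    y < maxIncrement x n ↔ ∃ k ∈ Finset.range (n + 1), ∃ i ∈ Finset.range (k + 1),
      y < x k - x i := by
  simp [maxIncrement, Finset.lt_sup'_iff]

theorem sub_le_maxIncrement {x : ℕ → ℝ} {n k i : ℕ} (hk : k ≤ n) (hi : i ≤ k) :
    x k - x i ≤ maxIncrement x n := by
  by_contra! h
  exact lt_irrefl _ (lt_maxIncrement_iff.mpr ⟨k, Finset.mem_range.mpr (by omega), i,
    Finset.mem_range.mpr (by omega), h⟩)

theorem measurable_maxIncrement {f : ℕ → Ω → ℝ} (hf : ∀ k, Measurable (f k)) (n : ℕ) :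
    Measurable fun ω => maxIncrement (fun k => f k ω) n := by
  refine measurable_of_Ioi fun y => ?_
  have : (fun ω => maxIncrement (fun k => f k ω) n) ⁻¹' Set.Ioi y =
      ⋃ k ∈ Finset.range (n + 1), ⋃ i ∈ Finset.range (k + 1), {ω | y < f k ω - f i ω} := by
    ext ω
    simp only [Set.mem_preimage, Set.mem_Ioi, lt_maxIncrement_iff, Set.mem_iUnion,
      Set.mem_ofPred_eq, exists_prop]
  rw [this]
  exact Finset.measurableSet_biUnion _ fun k _ => Finset.measurableSet_biUnion _ fun i _ =>
    ((hf k).sub (hf i)) measurableSet_Ioi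

theorem IsLevyProcess.mul_lintegral_exp_maxIncrement_le [IsProbabilityMeasure μ]
    (hX : IsLevyProcess μ ℱ X γ σ ν) {T K : ℝ} {p : ℝ≥0∞}
    (hp : ∀ r s, 0 ≤ r → r ≤ s → s ≤ T → p ≤ μ {ω | -K ≤ X s ω - X r ω})
    {t : ℕ → ℝ} (ht : Monotone t) (ht0 : 0 ≤ t 0) (htT : ∀ k, t k ≤ T) (n : ℕ) {q : ℝ}
    (hq : 0 < q) :
    p * p * ∫⁻ ω, ENNReal.ofReal (Real.exp (q * maxIncrement (fun k => X (t k) ω) n)) ∂μ ≤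
      ∫⁻ ω, ENNReal.ofReal (Real.exp (q * (X (t n) ω - X (t 0) ω + 2 * K))) ∂μ := by
  refine mul_lintegral_exp_le_of_measure_lt_le hq
    (measurable_maxIncrement (fun k => hX.measurable _) n)
    (((hX.measurable _).sub (hX.measurable _)).add_const _) _ fun y => ?_
  have h := hX.mul_measure_iUnion_lt_le hp ht ht0 htT n (y - 2 * K)
  convert h using 3
  · ext ω
    simp only [Set.mem_ofPred_eq, lt_maxIncrement_iff, Set.mem_iUnion, exists_prop,
      sub_add_cancel]
  · funext ω
    exact propext sub_lt_iff_lt_add.symm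

end LevyProcess

section Dyadic

/-- The dyadic points of rank `n`, stopped at `T`. -/
noncomputable def stoppedDyadic (n : ℕ) (T : ℝ) (i : ℕ) : ℝ := min T (i / 2 ^ n)

theorem stoppedDyadic_mono (n : ℕ) (T : ℝ) : Monotone (stoppedDyadic n T) := fun i j hij => by
  unfold stoppedDyadic
  gcongr

theorem stoppedDyadic_le (n : ℕ) (T : ℝ) (i : ℕ) : stoppedDyadic n T i ≤ T := min_le_left _ _

theorem stoppedDyadic_nonneg (n : ℕ) {T : ℝ} (hT : 0 ≤ T) (i : ℕ) : 0 ≤ stoppedDyadic n T i :=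
  le_min hT (by positivity)

theorem stoppedDyadic_zero (n : ℕ) {T : ℝ} (hT : 0 ≤ T) : stoppedDyadic n T 0 = 0 := by
  simp [stoppedDyadic, hT]

theorem le_stoppedDyadic_ceil (n : ℕ) {T u : ℝ} (huT : u ≤ T) :
    u ≤ stoppedDyadic n T ⌈u * 2 ^ n⌉₊ := by
  refine le_min huT ?_
  rw [le_div_iff₀ (by positivity)]
  exact Nat.le_ceil _

theorem stoppedDyadic_ceil_self (n : ℕ) (T : ℝ) : stoppedDyadic n T ⌈T * 2 ^ n⌉₊ = T :=
  le_antisymm (stoppedDyadic_le _ _ _) (le_stoppedDyadic_ceil n le_rfl)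

theorem tendsto_stoppedDyadic_ceil {T u : ℝ} (hu : 0 ≤ u) (huT : u ≤ T) :
    Tendsto (fun n => stoppedDyadic n T ⌈u * 2 ^ n⌉₊) atTop (𝓝[≥] u) := by
  refine tendsto_nhdsWithin_iff.mpr
    ⟨?_, Eventually.of_forall fun n => le_stoppedDyadic_ceil n huT⟩
  refine tendsto_of_tendsto_of_tendsto_of_le_of_le (g := fun _ => u)
    (h := fun n : ℕ => u + (1 / 2 : ℝ) ^ n) tendsto_const_nhds ?_
    (fun n => le_stoppedDyadic_ceil n huT) fun n => ?_
  · simpa using (tendsto_pow_atTop_nhds_zero_of_lt_one (r := (1 / 2 : ℝ)) (by norm_num)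
      (by norm_num)).const_add u
  · refine (min_le_right _ _).trans ?_
    rw [div_le_iff₀ (by positivity), add_mul, ← mul_pow]
    norm_num
    exact (Nat.ceil_lt_add_one (by positivity)).le

end Dyadic

section IncrementSup

variable {Ω : Type*} {X : ℝ → Ω → ℝ} {q a T : ℝ}

/-- The supremum of `exp (q * (X v - X u))` over `a ≤ u ≤ v ≤ T`. -/
noncomputable def expIncrementSup (X : ℝ → Ω → ℝ) (q a T : ℝ) (ω : Ω) : ℝ≥0∞ :=
  ⨆ r : {r : ℝ × ℝ // a ≤ r.1 ∧ r.1 ≤ r.2 ∧ r.2 ≤ T},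
    ENNReal.ofReal (Real.exp (q * (X r.1.2 ω - X r.1.1 ω)))

theorem le_expIncrementSup {u v : ℝ} (hau : a ≤ u) (huv : u ≤ v) (hvT : v ≤ T) (ω : Ω) :
    ENNReal.ofReal (Real.exp (q * (X v ω - X u ω))) ≤ expIncrementSup X q a T ω :=
  le_iSup (fun r : {r : ℝ × ℝ // a ≤ r.1 ∧ r.1 ≤ r.2 ∧ r.2 ≤ T} =>
    ENNReal.ofReal (Real.exp (q * (X r.1.2 ω - X r.1.1 ω)))) ⟨(u, v), hau, huv, hvT⟩

theorem expIncrementSup_antitone (ω : Ω) : Antitone fun a => expIncrementSup X q a T ω :=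
  fun _ _ hab => iSup_le fun r => le_expIncrementSup (hab.trans r.2.1) r.2.2.1 r.2.2.2 ω

theorem tendsto_ofReal_exp_increment {ω : Ω}
    (hX : ∀ t, ContinuousWithinAt (fun s => X s ω) (Set.Ici t) t) {u v : ℝ} (hu : 0 ≤ u)
    (huv : u ≤ v) (hvT : v ≤ T) :
    Tendsto (fun n => ENNReal.ofReal (Real.exp (q * (X (stoppedDyadic n T ⌈v * 2 ^ n⌉₊) ω -
      X (stoppedDyadic n T ⌈u * 2 ^ n⌉₊) ω)))) atTop
      (𝓝 (ENNReal.ofReal (Real.exp (q * (X v ω - X u ω))))) := by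
  have h1 := (hX v).tendsto.comp (tendsto_stoppedDyadic_ceil (hu.trans huv) hvT)
  have h2 := (hX u).tendsto.comp (tendsto_stoppedDyadic_ceil hu (huv.trans hvT))
  exact ENNReal.tendsto_ofReal ((Real.continuous_exp.tendsto _).comp ((h1.sub h2).const_mul q))

theorem expIncrementSup_eq_iSup {ω : Ω}
    (hX : ∀ t, ContinuousWithinAt (fun s => X s ω) (Set.Ici t) t) (ha : 0 ≤ a) :
    expIncrementSup X q a T ω =
      ⨆ k : {k : ℕ × ℕ × ℕ // a ≤ stoppedDyadic k.1 T k.2.1 ∧ k.2.1 ≤ k.2.2},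
        ENNReal.ofReal (Real.exp (q * (X (stoppedDyadic k.1.1 T k.1.2.2) ω -
          X (stoppedDyadic k.1.1 T k.1.2.1) ω))) := by
  refine le_antisymm (iSup_le fun ⟨⟨u, v⟩, hau, huv, hvT⟩ => ?_) (iSup_le fun k => ?_)
  · refine le_of_tendsto (tendsto_ofReal_exp_increment hX (ha.trans hau) huv hvT)
      (Eventually.of_forall fun n => ?_)
    exact le_iSup (fun k : {k : ℕ × ℕ × ℕ // a ≤ stoppedDyadic k.1 T k.2.1 ∧ k.2.1 ≤ k.2.2} =>
      ENNReal.ofReal (Real.exp (q * (X (stoppedDyadic k.1.1 T k.1.2.2) ω -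
        X (stoppedDyadic k.1.1 T k.1.2.1) ω)))) ⟨(n, ⌈u * 2 ^ n⌉₊, ⌈v * 2 ^ n⌉₊),
        hau.trans (le_stoppedDyadic_ceil n (huv.trans hvT)), by dsimp only; gcongr⟩
  · exact le_expIncrementSup k.2.1 (stoppedDyadic_mono _ _ k.2.2) (stoppedDyadic_le _ _ _) ω

theorem measurable_expIncrementSup
    (hX : ∀ ω t, ContinuousWithinAt (fun s => X s ω) (Set.Ici t) t) (ha : 0 ≤ a) :
    Measurable[futureSigma X a] (expIncrementSup X q a T) := by
  have h := funext fun ω => expIncrementSup_eq_iSup (q := q) (T := T) (hX ω) ha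
  change Measurable[futureSigma X a] fun ω => expIncrementSup X q a T ω
  rw [h]
  refine Measurable.iSup (mδ := futureSigma X a) fun k => ?_
  refine ENNReal.measurable_ofReal.comp (Real.measurable_exp.comp (Measurable.const_mul ?_ q))
  exact measurable_futureSigma_sub k.2.1 (k.2.1.trans (stoppedDyadic_mono _ _ k.2.2))

variable {m0 : MeasurableSpace Ω} {μ : Measure Ω} {ℱ : Filtration ℝ m0} {γ σ : ℝ} {ν : Measure ℝ}

theorem IsLevyProcess.lintegral_expIncrementSup_lt_top [IsProbabilityMeasure μ]
    (hX : IsLevyProcess μ ℱ X γ σ ν) (hν : IsLevyMeasure ν) (hT : 0 ≤ T) (hq0 : 0 < q)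
    (hq : IntegrableOn (fun x : ℝ => Real.exp (q * x)) {x : ℝ | 1 < |x|} ν) :
    ∫⁻ ω, expIncrementSup X q 0 T ω ∂μ < ⊤ := by
  obtain ⟨p, hp0, K, hp⟩ := hX.exists_le_measure T
  set C := ∫⁻ ω, ENNReal.ofReal (Real.exp (q * (X T ω - X 0 ω + 2 * K))) ∂μ with hC
  have hCtop : C < ⊤ := by
    have h : ∀ ω, ENNReal.ofReal (Real.exp (q * (X T ω - X 0 ω + 2 * K))) =
        ENNReal.ofReal (Real.exp (q * (2 * K))) * ENNReal.ofReal (Real.exp (q * X T ω)) :=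
      fun ω => by
        rw [← ENNReal.ofReal_mul (Real.exp_nonneg _), ← Real.exp_add, hX.2.1 ω]
        ring_nf
    rw [hC, lintegral_congr h, lintegral_const_mul' _ _ ENNReal.ofReal_ne_top]
    exact ENNReal.mul_lt_top ENNReal.ofReal_lt_top (hX.lintegral_exp_lt_top hν hT hq)
  let f : ℕ → Ω → ℝ≥0∞ := fun n ω => ENNReal.ofReal (Real.exp (q * maxIncrement
    (fun k => X (stoppedDyadic n T k) ω) ⌈T * 2 ^ n⌉₊))
  have hfm : ∀ n, Measurable (f n) := fun n => ENNReal.measurable_ofReal.comp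
    (Real.measurable_exp.comp ((measurable_maxIncrement (fun k => hX.measurable _) _).const_mul q))
  have hf : ∀ n, p * p * ∫⁻ ω, f n ω ∂μ ≤ C := fun n => by
    have h := hX.mul_lintegral_exp_maxIncrement_le hp (stoppedDyadic_mono n T)
      (stoppedDyadic_nonneg n hT 0) (stoppedDyadic_le n T) ⌈T * 2 ^ n⌉₊ hq0
    rwa [stoppedDyadic_ceil_self, stoppedDyadic_zero n hT] at h
  have hle : ∀ ω, expIncrementSup X q 0 T ω ≤ liminf (fun n => f n ω) atTop := fun ω =>
    iSup_le fun ⟨⟨u, v⟩, hu, huv, hvT⟩ => by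
      rw [← (tendsto_ofReal_exp_increment (q := q) (hX.2.2.1 ω) hu huv hvT).liminf_eq]
      refine liminf_le_liminf (Eventually.of_forall fun n => ?_)
      refine ENNReal.ofReal_le_ofReal (Real.exp_le_exp.mpr (mul_le_mul_of_nonneg_left ?_ hq0.le))
      exact sub_le_maxIncrement (x := fun k => X (stoppedDyadic n T k) ω)
        (by dsimp only; gcongr) (by dsimp only; gcongr)
  have hpp : p * p ≠ 0 := mul_ne_zero hp0 hp0
  have hptop : p * p ≠ ⊤ := by
    have h1 : p ≤ 1 := (hp 0 0 le_rfl le_rfl hT).trans prob_le_one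
    exact ENNReal.mul_ne_top (ne_top_of_le_ne_top ENNReal.one_ne_top h1)
      (ne_top_of_le_ne_top ENNReal.one_ne_top h1)
  calc ∫⁻ ω, expIncrementSup X q 0 T ω ∂μ ≤ ∫⁻ ω, liminf (fun n => f n ω) atTop ∂μ :=
        lintegral_mono hle
    _ ≤ liminf (fun n => ∫⁻ ω, f n ω ∂μ) atTop := lintegral_liminf_le hfm
    _ ≤ C / (p * p) := by
        refine liminf_le_of_le (by isBoundedDefault) fun b hb => ?_
        obtain ⟨n, hn⟩ := hb.exists
        refine hn.trans ?_
        rw [ENNReal.le_div_iff_mul_le (Or.inl hpp) (Or.inl hptop), mul_comm]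
        exact hf n
    _ < ⊤ := ENNReal.div_lt_top hCtop.ne hpp

end IncrementSup

section RunningSup

variable {x : ℝ → ℝ} {η a T ℓ : ℝ}

theorem bddAbove_range_exp_mul (hη : η ≤ 1) (h : ∀ u v, 0 ≤ u → u ≤ v → v ≤ T → x v - x u ≤ ℓ)
    {t : ℝ} (ht : t ≤ T) :
    BddAbove (Set.range fun u : Set.Icc 0 t => Real.exp ((η - 1) * x u)) := by
  refine ⟨Real.exp ((1 - η) * (ℓ - x t)), ?_⟩
  rintro _ ⟨u, rfl⟩
  have := h u t u.2.1 u.2.2 ht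
  refine Real.exp_le_exp.mpr ?_
  nlinarith [sub_nonneg.mpr hη]

theorem exp_mul_iSup_le (hη : η ∈ Set.Icc (0 : ℝ) 1) (ha : 0 ≤ a)
    (hbdd : BddAbove (Set.range fun u : Set.Icc 0 a => Real.exp ((η - 1) * x u)))
    (h : ∀ u v, a ≤ u → u ≤ v → v ≤ T → x v - x u ≤ ℓ) {t : ℝ} (hat : a ≤ t) (ht : t ≤ T) :
    Real.exp (x t) * ⨆ u : Set.Icc 0 t, Real.exp ((η - 1) * x u) ≤
      Real.exp (x a) * (⨆ u : Set.Icc 0 a, Real.exp ((η - 1) * x u)) * Real.exp ℓ := by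
  have : Nonempty (Set.Icc 0 t) := ⟨⟨0, le_rfl, ha.trans hat⟩⟩
  have hta := h a t le_rfl hat ht
  rw [mul_comm, ← le_div_iff₀ (Real.exp_pos _)]
  refine ciSup_le fun u => ?_
  rw [le_div_iff₀ (Real.exp_pos _)]
  rcases le_total (u : ℝ) a with hua | hua
  · calc Real.exp ((η - 1) * x u) * Real.exp (x t)
        ≤ (⨆ u : Set.Icc 0 a, Real.exp ((η - 1) * x u)) * Real.exp (x a + ℓ) := by
          gcongr
          · exact Real.iSup_nonneg fun u => Real.exp_nonneg _
          · exact le_ciSup hbdd ⟨u, u.2.1, hua⟩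
          · linarith
      _ = _ := by rw [Real.exp_add]; ring
  · have htu := h u t hua u.2.2 ht
    calc Real.exp ((η - 1) * x u) * Real.exp (x t)
        ≤ Real.exp ((η - 1) * x a) * Real.exp (x a + ℓ) := by
          rw [← Real.exp_add, ← Real.exp_add, Real.exp_le_exp]
          nlinarith [mul_le_mul_of_nonneg_left htu (sub_nonneg.mpr hη.2),
            mul_le_mul_of_nonneg_left hta hη.1]
      _ ≤ (⨆ u : Set.Icc 0 a, Real.exp ((η - 1) * x u)) * Real.exp (x a + ℓ) := by
          gcongr
          exact le_ciSup hbdd ⟨a, ha, le_rfl⟩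
      _ = _ := by rw [Real.exp_add]; ring

theorem iSup_Icc_eq_iSup_stoppedDyadic {f : ℝ → ℝ}
    (hf : ∀ t, ContinuousWithinAt f (Set.Ici t) t) (ha : 0 ≤ a) :
    ⨆ u : Set.Icc 0 a, f u = ⨆ k : ℕ × ℕ, f (stoppedDyadic k.1 a k.2) := by
  have : Nonempty (Set.Icc 0 a) := ⟨⟨0, le_rfl, ha⟩⟩
  have h1 : ∀ b, (∀ k : ℕ × ℕ, f (stoppedDyadic k.1 a k.2) ≤ b) → ∀ u : Set.Icc 0 a, f u ≤ b :=
    fun b hb u => le_of_tendsto ((hf u).tendsto.comp (tendsto_stoppedDyadic_ceil u.2.1 u.2.2))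
      (Eventually.of_forall fun n => hb (n, _))
  have h2 : ∀ b, (∀ u : Set.Icc 0 a, f u ≤ b) → ∀ k : ℕ × ℕ, f (stoppedDyadic k.1 a k.2) ≤ b :=
    fun b hb k => hb ⟨_, stoppedDyadic_nonneg _ ha _, stoppedDyadic_le _ _ _⟩
  by_cases hbdd : BddAbove (Set.range fun u : Set.Icc 0 a => f u)
  · obtain ⟨b, hb⟩ := hbdd
    have hb' := h2 b fun u => hb ⟨u, rfl⟩
    refine le_antisymm (ciSup_le (h1 _ fun k => ?_)) (ciSup_le (h2 _ fun u => ?_))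
    · exact le_ciSup (f := fun k : ℕ × ℕ => f (stoppedDyadic k.1 a k.2))
        ⟨b, by rintro _ ⟨k, rfl⟩; exact hb' k⟩ k
    · exact le_ciSup (f := fun u : Set.Icc 0 a => f u) ⟨b, hb⟩ u
  · rw [Real.iSup_of_not_bddAbove hbdd, Real.iSup_of_not_bddAbove]
    rintro ⟨b, hb⟩
    refine hbdd ⟨b, ?_⟩
    rintro _ ⟨u, rfl⟩
    exact h1 b (fun k => hb ⟨k, rfl⟩) u

theorem measurable_iSup_Icc {Ω : Type*} {m0 : MeasurableSpace Ω} {ℱ : Filtration ℝ m0}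
    {Y : ℝ → Ω → ℝ} (hY : Adapted ℱ Y)
    (hc : ∀ ω t, ContinuousWithinAt (fun s => Y s ω) (Set.Ici t) t) (ha : 0 ≤ a) :
    Measurable[ℱ a] fun ω => ⨆ u : Set.Icc 0 a, Y u ω := by
  have h := funext fun ω => iSup_Icc_eq_iSup_stoppedDyadic (hc ω) ha
  rw [h]
  exact Measurable.iSup (mδ := ℱ a) fun k =>
    (hY _).mono (ℱ.mono (stoppedDyadic_le _ _ _)) le_rfl

end RunningSup

theorem condExp_le_integral_mul_of_indep {Ω : Type*} {m m' m0 : MeasurableSpace Ω} {μ : Measure Ω}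
    [IsProbabilityMeasure μ] (hm : m ≤ m0) (hm' : m' ≤ m0) (hindep : Indep m' m μ)
    {F Z W : Ω → ℝ} (hZ : Measurable[m] Z) (hW : Measurable[m'] W) (hWint : Integrable W μ)
    (hZ0 : 0 ≤ Z) (hW0 : 0 ≤ W) (hZF : Z ≤ᵐ[μ] F) (hFZW : F ≤ᵐ[μ] Z * W) :
    μ[F | m] ≤ᵐ[μ] fun ω => (∫ ω, W ω ∂μ) * Z ω := by
  by_cases hF : Integrable F μ
  · have hZint : Integrable Z μ := hF.mono (hZ.mono hm le_rfl).aestronglyMeasurable (by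
      filter_upwards [hZF] with ω hω
      rw [Real.norm_of_nonneg (hZ0 ω)]
      exact hω.trans (le_abs_self _))
    have hind : IndepFun Z W μ := by
      rw [IndepFun_iff_Indep]
      exact (indep_of_indep_of_le_left (indep_of_indep_of_le_right hindep hZ.comap_le)
        hW.comap_le).symm
    have hZW : Integrable (Z * W) μ := hind.integrable_mul hZint hWint
    have h1 := condExp_mono (m := m) hF hZW hFZW
    have h2 := condExp_mul_of_stronglyMeasurable_left hZ.stronglyMeasurable hZW hWint
    have h3 := condExp_indep_eq hm' hm hW.stronglyMeasurable hindep
    filter_upwards [h1, h2, h3] with ω h1 h2 h3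
    rw [h2, Pi.mul_apply, h3, mul_comm] at h1
    exact h1
  · rw [condExp_of_not_integrable hF]
    exact ae_of_all _ fun ω => mul_nonneg (integral_nonneg hW0) (hZ0 ω)

theorem sub_le_log_expIncrementSup {Ω : Type*} {X : ℝ → Ω → ℝ} {q a T : ℝ} (hq : 0 < q) {ω : Ω}
    (h : expIncrementSup X q a T ω ≠ ⊤) {u v : ℝ} (hau : a ≤ u) (huv : u ≤ v) (hvT : v ≤ T) :
    X v ω - X u ω ≤ Real.log (expIncrementSup X q a T ω).toReal / q := by
  have h1 := (ENNReal.ofReal_le_iff_le_toReal h).mp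
    (le_expIncrementSup (X := X) (q := q) hau huv hvT ω)
  rw [le_div_iff₀' hq]
  exact (Real.le_log_iff_exp_le ((Real.exp_pos _).trans_le h1)).mpr h1

theorem iSup_rpow_le_mul_expIncrementSup {Ω : Type*} {X : ℝ → Ω → ℝ} {q a T η : ℝ} (hq : 0 < q)
    (hη : η ∈ Set.Icc (0 : ℝ) 1) (ha : a ∈ Set.Icc 0 T) {ω : Ω}
    (h : expIncrementSup X q 0 T ω ≠ ⊤) :
    (Real.exp (X a ω) * ⨆ u : Set.Icc 0 a, Real.exp ((η - 1) * X u ω)) ^ q ≤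
      (⨆ t : Set.Icc a T, (Real.exp (X t ω) *
        ⨆ u : Set.Icc 0 (t : ℝ), Real.exp ((η - 1) * X u ω))) ^ q ∧
    (⨆ t : Set.Icc a T, (Real.exp (X t ω) *
        ⨆ u : Set.Icc 0 (t : ℝ), Real.exp ((η - 1) * X u ω))) ^ q ≤
      (Real.exp (X a ω) * ⨆ u : Set.Icc 0 a, Real.exp ((η - 1) * X u ω)) ^ q *
        (expIncrementSup X q a T ω).toReal := by
  have : Nonempty (Set.Icc a T) := ⟨⟨a, le_rfl, ha.2⟩⟩
  have hatop : expIncrementSup X q a T ω ≠ ⊤ :=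
    ne_top_of_le_ne_top h (expIncrementSup_antitone ω ha.1)
  have hbdd : BddAbove (Set.range fun u : Set.Icc 0 a => Real.exp ((η - 1) * X u ω)) :=
    bddAbove_range_exp_mul (x := fun s => X s ω) hη.2
      (fun u v hu huv hv => sub_le_log_expIncrementSup hq h hu huv hv) ha.2
  have hle : ∀ t : Set.Icc a T, Real.exp (X t ω) *
      (⨆ u : Set.Icc 0 (t : ℝ), Real.exp ((η - 1) * X u ω)) ≤ _ := fun t =>
    exp_mul_iSup_le (x := fun s => X s ω) hη ha.1 hbdd
      (fun u v hu huv hv => sub_le_log_expIncrementSup hq hatop hu huv hv) t.2.1 t.2.2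
  have hM : 0 ≤ Real.exp (X a ω) * ⨆ u : Set.Icc 0 a, Real.exp ((η - 1) * X u ω) :=
    mul_nonneg (Real.exp_nonneg _) (Real.iSup_nonneg fun u => Real.exp_nonneg _)
  have hMS : Real.exp (X a ω) * (⨆ u : Set.Icc 0 a, Real.exp ((η - 1) * X u ω)) ≤
      ⨆ t : Set.Icc a T, (Real.exp (X t ω) *
        ⨆ u : Set.Icc 0 (t : ℝ), Real.exp ((η - 1) * X u ω)) :=
    le_ciSup (f := fun t : Set.Icc a T => Real.exp (X t ω) *
        ⨆ u : Set.Icc 0 (t : ℝ), Real.exp ((η - 1) * X u ω))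
      ⟨_, by rintro _ ⟨t, rfl⟩; exact hle t⟩ ⟨a, le_rfl, ha.2⟩
  refine ⟨Real.rpow_le_rpow hM hMS hq.le, ?_⟩
  have hpos : 0 < (expIncrementSup X q a T ω).toReal :=
    (Real.exp_pos _).trans_le ((ENNReal.ofReal_le_iff_le_toReal hatop).mp
      (le_expIncrementSup (X := X) (q := q) le_rfl ha.2 le_rfl ω))
  refine (Real.rpow_le_rpow (hM.trans hMS) (ciSup_le hle) hq.le).trans_eq ?_
  rw [Real.mul_rpow hM (Real.exp_nonneg _), ← Real.exp_mul, div_mul_cancel₀ _ hq.ne',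
    Real.exp_log hpos]

/-- if `∫_{|x|>1} e^{qx} ν(dx) < ∞` for some `q ∈ (1,∞)`, then for every
`η ∈ [0,1]` the weight `Φ(η)_t = e^{X_t} sup_{u∈[0,t]} e^{(η-1)X_u}` belongs to `𝒮ℳ_q`:
`𝔼[sup_{t∈[a,T]} Φ(η)_t^q | ℱ_a] ≤ c^q Φ(η)_a^q` a.s. for all `a ∈ [0,T]`. -/
theorem stmt17 {Ω : Type*} {m0 : MeasurableSpace Ω} (μ : Measure Ω) [IsProbabilityMeasure μ]
    (T q : ℝ) (hT : 0 < T) (hq : 1 < q)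
    (γ σ : ℝ) (ν : Measure ℝ) (hν : IsLevyMeasure ν)
    (X : ℝ → Ω → ℝ) (ℱ : Filtration ℝ m0)
    (hX : IsLevyProcess μ ℱ X γ σ ν)
    (hbig : ∫⁻ x in {x : ℝ | 1 < |x|}, ENNReal.ofReal (Real.exp (q * x)) ∂ν < ⊤)
    (η : ℝ) (hη : η ∈ Set.Icc (0 : ℝ) 1) :
    ∃ c ≥ 0, ∀ a ∈ Set.Icc (0 : ℝ) T, ∀ᵐ ω ∂μ,
      (μ[fun ω => (⨆ t : Set.Icc a T,
          (Real.exp (X (t : ℝ) ω) * ⨆ u : Set.Icc 0 (t : ℝ),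
            Real.exp ((η - 1) * X (u : ℝ) ω))) ^ q|ℱ a]) ω
        ≤ c ^ q * (Real.exp (X a ω) *
            ⨆ u : Set.Icc (0 : ℝ) a, Real.exp ((η - 1) * X (u : ℝ) ω)) ^ q := by
  have hq0 : 0 < q := one_pos.trans hq
  have hexp : IntegrableOn (fun x : ℝ => Real.exp (q * x)) {x : ℝ | 1 < |x|} ν := by
    refine ⟨(by fun_prop : Measurable fun x : ℝ => Real.exp (q * x)).aestronglyMeasurable, ?_⟩
    rw [hasFiniteIntegral_iff_ofReal (ae_of_all _ fun x => Real.exp_nonneg _)]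
    exact hbig
  have hfin := hX.lintegral_expIncrementSup_lt_top hν hT.le hq0 hexp
  set C := (∫⁻ ω, expIncrementSup X q 0 T ω ∂μ).toReal with hC
  refine ⟨C ^ (1 / q), by positivity, fun a ha => ?_⟩
  have hmeas : ∀ b, 0 ≤ b → Measurable[futureSigma X b] (expIncrementSup X q b T) :=
    fun b hb => measurable_expIncrementSup hX.2.2.1 hb
  have hmeas0 : ∀ b, 0 ≤ b → Measurable (expIncrementSup X q b T) :=
    fun b hb => (hmeas b hb).mono (futureSigma_le hX.1 b) le_rfl
  have hmono : ∫⁻ ω, expIncrementSup X q a T ω ∂μ ≤ ∫⁻ ω, expIncrementSup X q 0 T ω ∂μ :=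
    lintegral_mono fun ω => expIncrementSup_antitone ω ha.1
  have hZ : Measurable[ℱ a] fun ω => (Real.exp (X a ω) *
      ⨆ u : Set.Icc (0 : ℝ) a, Real.exp ((η - 1) * X (u : ℝ) ω)) ^ q := by
    have hG : Measurable[ℱ a] fun ω =>
        ⨆ u : Set.Icc (0 : ℝ) a, Real.exp ((η - 1) * X (u : ℝ) ω) :=
      measurable_iSup_Icc (Y := fun t ω => Real.exp ((η - 1) * X t ω))
        (fun t => Real.measurable_exp.comp ((hX.1 t).const_mul _))
        (fun ω t => ((hX.2.2.1 ω t).const_mul _).rexp) ha.1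
    exact ((Real.measurable_exp.comp (hX.1 a)).mul hG).pow_const q
  have hpt : ∀ᵐ ω ∂μ, expIncrementSup X q 0 T ω ≠ ⊤ := by
    filter_upwards [ae_lt_top (hmeas0 0 le_rfl) hfin.ne] with ω hω using hω.ne
  have hcond := condExp_le_integral_mul_of_indep (ℱ.le a) (futureSigma_le hX.1 a)
    (indep_futureSigma hX.1 (fun s t hs hst => hX.indep_incrementSigma hs hst) ha.1)
    hZ (hmeas a ha.1).ennreal_toReal
    (integrable_toReal_of_lintegral_ne_top (hmeas0 a ha.1).aemeasurable
      (hmono.trans_lt hfin).ne)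
    (fun ω => Real.rpow_nonneg (mul_nonneg (Real.exp_nonneg _)
      (Real.iSup_nonneg fun u => Real.exp_nonneg _)) q)
    (fun ω => ENNReal.toReal_nonneg)
    (hpt.mono fun ω hω => (iSup_rpow_le_mul_expIncrementSup hq0 hη ha hω).1)
    (hpt.mono fun ω hω => (iSup_rpow_le_mul_expIncrementSup hq0 hη ha hω).2)
  filter_upwards [hcond] with ω hω
  refine hω.trans (mul_le_mul_of_nonneg_right ?_ (Real.rpow_nonneg (mul_nonneg (Real.exp_nonneg _)
    (Real.iSup_nonneg fun u => Real.exp_nonneg _)) q))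
  rw [← Real.rpow_mul ENNReal.toReal_nonneg, one_div_mul_cancel hq0.ne', Real.rpow_one,
    integral_toReal (hmeas0 a ha.1).aemeasurable (by
      filter_upwards [hpt] with ω hω
      exact (lt_of_le_of_lt (expIncrementSup_antitone ω ha.1) hω.lt_top))]
  exact ENNReal.toReal_mono hfin.ne hmono
end
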